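/- Let K be an algebraically closed field and let f ∈ K[[x,y]] be a reduced elementary power series of bidegree (m,n), with d = gcd(m,n). Then μ̄(f) − (n−1)(m−1) ≥ d − r(f) ≥ 0. Moreover, if f is non-degenerate then μ̄(f) = (n−1)(m−1) and r(f) = d. -/

import Mathlib

/-!
Common definitions for formalizing "A note on the plane curve singularities in
positive characteristic" by E. García Barroso and A. Płoski.

We work with the ring `K[[x,y]] := MvPowerSeries (Fin 2) K`, where `x` is the
variable of index `0` and `y` the variable of index `1`.
-/

open scoped Classical

noncomputable section

universe u

namespace PlaneCurveNote

/-- The formal power series ring `K[[x,y]]`. -/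
abbrev PS (K : Type u) [Field K] := MvPowerSeries (Fin 2) K

variable (K : Type u) [Field K]

/-- The variable `x`. -/
def Xv : PS K := MvPowerSeries.X 0

/-- The variable `y`. -/
def Yv : PS K := MvPowerSeries.X 1

/-- The coefficient `c_{αβ}` of `x^α y^β` in `f`. -/
def coef (f : PS K) (p : ℕ × ℕ) : K :=
  MvPowerSeries.coeff (R := K) (Finsupp.single 0 p.1 + Finsupp.single 1 p.2) f

/-- The support of a power series, as a subset of `ℕ²`. -/
def supp (f : PS K) : Set (ℕ × ℕ) := {p | coef K f p ≠ 0}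

/-- Build a power series from a coefficient function on `ℕ²`. -/
def ofCoef (c : ℕ × ℕ → K) : PS K := fun d => c (d 0, d 1)

/-- A reduced power series: nonzero, without constant term and without multiple factors. -/
def IsReducedSeries (f : PS K) : Prop :=
  f ≠ 0 ∧ MvPowerSeries.constantCoeff (σ := Fin 2) (R := K) f = 0 ∧ Squarefree f

/-- `r(f)`: the number of irreducible factors of `f` (counted up to associates,
i.e. the number of distinct irreducible components of the curve `f = 0` when `f` is reduced). -/
def numFactors (f : PS K) : ℕ :=
  Set.ncard {P : Associates (PS K) | Irreducible P ∧ P ∣ Associates.mk f}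

/-- The local ring `O_f = K[[x,y]]/(f)` of the curve `f = 0`. -/
abbrev CurveRing (f : PS K) := PS K ⧸ Ideal.span ({f} : Set (PS K))

/-- `deltaSpec K f d` expresses that `d = δ(f) = dim_K Ō_f/O_f`, where `Ō_f` is the integral
closure of `O_f = K[[x,y]]/(f)` in (any model `L` of) its total ring of fractions. -/
def deltaSpec (f : PS K) (d : ℕ) : Prop :=
  ∀ (L : Type u) [CommRing L] [Algebra K L] [Algebra (CurveRing K f) L]
    [IsScalarTower K (CurveRing K f) L] [IsFractionRing (CurveRing K f) L],
    letI N : Submodule K L := Submodule.span K ((integralClosure (CurveRing K f) L : Set L))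
    letI P : Submodule K L := Submodule.span K (Set.range (algebraMap (CurveRing K f) L))
    d = Module.finrank K (↥N ⧸ (P.comap N.subtype))

/-- `δ(f)`, the delta invariant of `f`. -/
def delta (f : PS K) : ℕ := sInf {d | deltaSpec K f d}

/-- `μ̄(f) = 2δ(f) - r(f) + 1`, the invariant Milnor number of `f`. -/
def muBar (f : PS K) : ℤ := 2 * (delta K f : ℤ) - (numFactors K f : ℤ) + 1

/-- `i₀(f,g) = dim_K K[[x,y]]/(f,g)`, the intersection multiplicity of `f` and `g`
(as a natural number; meaningful when it is finite). -/
def iMult (f g : PS K) : ℕ :=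
  Module.finrank K (PS K ⧸ Ideal.span ({f, g} : Set (PS K)))

/-- `i₀(f,g)` as a cardinal (`dim_K K[[x,y]]/(f,g)`), allowing the infinite case. -/
def iMultC (f g : PS K) : Cardinal :=
  Module.rank K (PS K ⧸ Ideal.span ({f, g} : Set (PS K)))

/-- `Γ(f)`: the semigroup of values of an irreducible `f`, i.e. the set of intersection
multiplicities `i₀(f,g)` where `g` runs over power series with `g ≢ 0 (mod f)`. -/
def valueSemigroup (f : PS K) : Set ℕ :=
  {n | ∃ g : PS K, ¬ f ∣ g ∧ n = iMult K f g}

/-- `ord f`, the order of a power series. -/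
def ordSeries (f : PS K) : ℕ := sInf ((fun p => p.1 + p.2) '' supp K f)

/-- `m = ord f(x,0)`. -/
def ordX (f : PS K) : ℕ := sInf {a : ℕ | (a, 0) ∈ supp K f}

/-- `n = ord f(0,y)`. -/
def ordY (f : PS K) : ℕ := sInf {b : ℕ | (0, b) ∈ supp K f}

/-- `f` is convenient if `f(x,0) f(0,y) ≠ 0`. -/
def Convenient (f : PS K) : Prop :=
  (∃ a : ℕ, (a, 0) ∈ supp K f) ∧ (∃ b : ℕ, (0, b) ∈ supp K f)

/-- A Newton edge: a segment with vertices `(α,β)`, `(α',β') ∈ ℕ²`, `α < α'`, `β' < β`. -/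
structure NEdge : Type where
  A : ℕ × ℕ
  B : ℕ × ℕ
  hx : A.1 < B.1
  hy : B.2 < A.2

/-- `|S|₁ = α' - α`. -/
def NEdge.len1 (S : NEdge) : ℕ := S.B.1 - S.A.1

/-- `|S|₂ = β - β'`. -/
def NEdge.len2 (S : NEdge) : ℕ := S.A.2 - S.B.2

/-- `r(S) = gcd(|S|₁, |S|₂)`. -/
def NEdge.rE (S : NEdge) : ℕ := Nat.gcd S.len1 S.len2

/-- The lattice points lying on the segment `S`. -/
def NEdge.mem (S : NEdge) (p : ℕ × ℕ) : Prop :=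
  S.A.1 ≤ p.1 ∧ p.1 ≤ S.B.1 ∧ S.B.2 ≤ p.2 ∧ p.2 ≤ S.A.2 ∧
    (p.1 - S.A.1) * S.len2 = (S.A.2 - p.2) * S.len1

/-- `[S,T] = min{|S|₁|T|₂, |S|₂|T|₁}`. -/
def bracket (S T : NEdge) : ℕ := min (S.len1 * T.len2) (S.len2 * T.len1)

/-- The Newton polygon `N_f` of `f`, described as the set of compact edges of the boundary of
the Newton diagram of `f`: an edge belongs to `N_f` iff its endpoints lie in the support of `f`
and some weight vector `w` with positive entries attains its minimum on the support of `f`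
exactly on this segment. -/
def newtonPolygon (f : PS K) : Set NEdge :=
  {S | S.A ∈ supp K f ∧ S.B ∈ supp K f ∧
    ∃ w : ℕ × ℕ, 0 < w.1 ∧ 0 < w.2 ∧
      w.1 * S.B.1 + w.2 * S.B.2 = w.1 * S.A.1 + w.2 * S.A.2 ∧
      (∀ p ∈ supp K f, w.1 * S.A.1 + w.2 * S.A.2 ≤ w.1 * p.1 + w.2 * p.2) ∧
      (∀ p ∈ supp K f, w.1 * p.1 + w.2 * p.2 = w.1 * S.A.1 + w.2 * S.A.2 →
        S.A.1 ≤ p.1 ∧ p.1 ≤ S.B.1)}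

/-- `|N_f|₁ = Σ_{S ∈ N_f} |S|₁`. -/
def len1N (f : PS K) : ℕ := ∑ᶠ S ∈ newtonPolygon K f, S.len1

/-- `|N_f|₂ = Σ_{S ∈ N_f} |S|₂`. -/
def len2N (f : PS K) : ℕ := ∑ᶠ S ∈ newtonPolygon K f, S.len2

/-- `[N_f, N_f] = Σ_{S,T ∈ N_f} [S,T]`. -/
def bracketN (f : PS K) : ℕ := ∑ᶠ S ∈ newtonPolygon K f, ∑ᶠ T ∈ newtonPolygon K f, bracket S T

/-- `k`: the exponent of the highest power of `x` dividing `f`. -/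
def kdiv (f : PS K) : ℕ := sInf {a : ℕ | ∃ b : ℕ, (a, b) ∈ supp K f}

/-- `l`: the exponent of the highest power of `y` dividing `f`. -/
def ldiv (f : PS K) : ℕ := sInf {b : ℕ | ∃ a : ℕ, (a, b) ∈ supp K f}

/-- `r(N_f) = Σ_{S ∈ N_f} r(S) + k + l`, where `x^k y^l` is the monomial of highest degree
dividing `f`. -/
def rNewton (f : PS K) : ℕ := (∑ᶠ S ∈ newtonPolygon K f, S.rE) + kdiv K f + ldiv K f

/-- `μ(N_f) = [N_f,N_f] - |N_f|₁ - |N_f|₂ + 1` (the Newton number of a convenient series). -/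
def muNewtonConv (f : PS K) : ℤ :=
  (bracketN K f : ℤ) - (len1N K f : ℤ) - (len2N K f : ℤ) + 1

/-- `μ(N_f) = sup_{m ∈ ℕ} μ(N_{f + x^m + y^m})`: the Newton number of an arbitrary
(reduced) power series. -/
def muNewton (f : PS K) : ℤ :=
  sSup {z : ℤ | ∃ m : ℕ, z = muNewtonConv K (f + Xv K ^ m + Yv K ^ m)}

/-- `δ(N_f) = (μ(N_f) + r(N_f) - 1)/2`. -/
def deltaNewton (f : PS K) : ℤ := (muNewton K f + (rNewton K f : ℤ) - 1) / 2

/-- `in(f,S) = Σ_{(α,β) ∈ S} c_{αβ} x^α y^β`, the initial part of `f` along the edge `S`. -/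
def initialForm (f : PS K) (S : NEdge) : PS K :=
  ofCoef K fun p => if S.mem p then coef K f p else 0

/-- `ī(f,S)`: the convenient power series with `in(f,S) = x^{α(S)} y^{β(S)} ī(f,S)`,
where `x^{α(S)} y^{β(S)}` is the monomial of highest degree dividing `in(f,S)`. -/
def inBar (f : PS K) (S : NEdge) : PS K :=
  ofCoef K fun p =>
    if S.mem (p.1 + S.A.1, p.2 + S.B.2) then coef K f (p.1 + S.A.1, p.2 + S.B.2) else 0

/-- `f` is non-degenerate (in the sense of Beelen–Pellikaan) if `ī(f,S)` is reduced
(i.e. squarefree) for every edge `S ∈ N_f`. -/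
def NonDegenerate (f : PS K) : Prop :=
  ∀ S ∈ newtonPolygon K f, Squarefree (inBar K f S)

/-- `f` is elementary if it is convenient and `N_f` consists of a single edge. -/
def Elementary (f : PS K) : Prop :=
  Convenient K f ∧ ∃ S : NEdge, newtonPolygon K f = {S}

/-- Evaluation of a power series with finite support (e.g. an initial form) at a point of `K²`. -/
def psEval (f : PS K) (v : K × K) : K :=
  ∑ᶠ p : ℕ × ℕ, coef K f p * v.1 ^ p.1 * v.2 ^ p.2

/-- The partial derivative `∂f/∂x` (for `i = 0`) resp. `∂f/∂y` (for `i = 1`). -/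
def pderivSeries (i : Fin 2) (f : PS K) : PS K :=
  ofCoef K fun p =>
    if i = 0 then ((p.1 + 1 : ℕ) : K) * coef K f (p.1 + 1, p.2)
    else ((p.2 + 1 : ℕ) : K) * coef K f (p.1, p.2 + 1)

/-- `μ(f) = i₀(∂f/∂x, ∂f/∂y)`, the Milnor number of `f`. -/
def milnor (f : PS K) : ℕ := iMult K (pderivSeries K 0 f) (pderivSeries K 1 f)

/-- `f` is strongly non-degenerate (Kouchnirenko) if for every `S ∈ N_f` the solutions of
`∂in(f,S)/∂x = ∂in(f,S)/∂y = 0` are contained in `{xy = 0}`. -/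
def StronglyNonDegenerate (f : PS K) : Prop :=
  ∀ S ∈ newtonPolygon K f, ∀ v : K × K,
    psEval K (pderivSeries K 0 (initialForm K f S)) v = 0 →
    psEval K (pderivSeries K 1 (initialForm K f S)) v = 0 → v.1 * v.2 = 0

/-- The Newton diagram `Δ(f) ⊆ ℝ²`: the convex hull of `supp f + (ℝ_{≥0})²`. -/
def diagram (f : PS K) : Set (ℝ × ℝ) :=
  convexHull ℝ {q : ℝ × ℝ | ∃ p ∈ supp K f, (p.1 : ℝ) ≤ q.1 ∧ (p.2 : ℝ) ≤ q.2}

/-- A real point lies on the Newton polygon `N_f` (i.e. on a compact face of the boundary of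
the Newton diagram) iff it belongs to the diagram and some linear form with positive
coefficients attains its minimum over the diagram at this point. -/
def OnNewtonPolygon (f : PS K) (q : ℝ × ℝ) : Prop :=
  q ∈ diagram K f ∧ ∃ w : ℝ × ℝ, 0 < w.1 ∧ 0 < w.2 ∧
    ∀ p ∈ diagram K f, w.1 * q.1 + w.2 * q.2 ≤ w.1 * p.1 + w.2 * p.2

section IteratedSeries

variable {K : Type u} [Field K]

open PowerSeries in
instance isAdicComplete_maximalIdeal_powerSeries :
    IsAdicComplete (IsLocalRing.maximalIdeal K⟦X⟧) K⟦X⟧ := by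
  rw [PowerSeries.maximalIdeal_eq_span_X]
  infer_instance

/-- The bijection between the variables `x, y` and `Option Unit` making `y` the outer variable. -/
def finTwoEquivOption : Fin 2 ≃ Option Unit where
  toFun i := if i = 1 then none else some ()
  invFun o := o.elim 1 fun _ => 0
  left_inv i := by fin_cases i <;> simp
  right_inv o := by rcases o with _ | ⟨⟩ <;> simp

open PowerSeries in
/-- The identification of `K[[x,y]]` with `K[[x]][[y]]`. -/
def toIter : PS K ≃ₐ[K] K⟦X⟧⟦X⟧ :=
  (MvPowerSeries.renameEquiv K finTwoEquivOption).trans (MvPowerSeries.optionEquivLeft Unit K)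

theorem coeff_toIter (f : PS K) (a b : ℕ) :
    PowerSeries.coeff a (PowerSeries.coeff b (toIter f)) = coef K f (a, b) := by
  have h := MvPowerSeries.coeff_coeff_optionEquivLeft
    (MvPowerSeries.renameEquiv K finTwoEquivOption f) b (Finsupp.single () a)
  refine h.trans ?_
  have h2 := MvPowerSeries.coeff_embDomain_rename (R := K) finTwoEquivOption.toEmbedding f
    (Finsupp.single 0 a + Finsupp.single 1 b)
  unfold coef
  rw [← h2]
  change _ = MvPowerSeries.coeff _ (MvPowerSeries.renameEquiv K finTwoEquivOption f)
  congr 1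
  congr 1
  ext i
  rw [Finsupp.embDomain_eq_mapDomain, Finsupp.mapDomain_add, Finsupp.mapDomain_single,
    Finsupp.mapDomain_single]
  rcases i with _ | ⟨⟩ <;> simp [finTwoEquivOption]

open PowerSeries in
theorem coeff_coeff_mul (G H : K⟦X⟧⟦X⟧) (a b : ℕ) :
    coeff a (coeff b (G * H)) = ∑ p ∈ Finset.HasAntidiagonal.antidiagonal b, ∑ q ∈ Finset.HasAntidiagonal.antidiagonal a,
      coeff q.1 (coeff p.1 G) * coeff q.2 (coeff p.2 H) := by
  simp only [PowerSeries.coeff_mul, map_sum]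

open PowerSeries in
theorem weight_le_of_mul {G : K⟦X⟧⟦X⟧} {α β N : ℕ}
    (hG : ∀ a b, coeff a (coeff b G) ≠ 0 → N ≤ α * a + β * b) (H : K⟦X⟧⟦X⟧) (a b : ℕ)
    (h : coeff a (coeff b (G * H)) ≠ 0) : N ≤ α * a + β * b := by
  rw [coeff_coeff_mul] at h
  obtain ⟨p, hp, h⟩ := Finset.exists_ne_zero_of_sum_ne_zero h
  obtain ⟨q, hq, h⟩ := Finset.exists_ne_zero_of_sum_ne_zero h
  have h1 := hG _ _ (left_ne_zero_of_mul h)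
  rw [Finset.HasAntidiagonal.mem_antidiagonal] at hp hq
  rw [← hp, ← hq]
  nlinarith

open PowerSeries in
theorem coeff_mul_of_weight_eq {G : K⟦X⟧⟦X⟧} {α β N : ℕ} (hα : 0 < α) (hβ : 0 < β)
    (hG : ∀ a b, coeff a (coeff b G) ≠ 0 → N ≤ α * a + β * b) (H : K⟦X⟧⟦X⟧) (a b : ℕ)
    (h : α * a + β * b = N) :
    coeff a (coeff b (G * H)) = coeff a (coeff b G) * coeff 0 (coeff 0 H) := by
  rw [coeff_coeff_mul, Finset.sum_eq_single (b, 0), Finset.sum_eq_single (a, 0)]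
  · rintro ⟨q1, q2⟩ hq hne
    rw [Finset.HasAntidiagonal.mem_antidiagonal] at hq
    by_contra hc
    have h1 := hG _ _ (left_ne_zero_of_mul hc)
    simp only at hq h1
    have hq2 : 0 < q2 := by
      rcases Nat.eq_zero_or_pos q2 with h0 | h0
      · exact absurd (by simp [h0] at hq ⊢; exact hq) hne
      · exact h0
    nlinarith
  · simp
  · rintro ⟨p1, p2⟩ hp hne
    rw [Finset.HasAntidiagonal.mem_antidiagonal] at hp
    refine Finset.sum_eq_zero ?_
    rintro ⟨q1, q2⟩ hq
    rw [Finset.HasAntidiagonal.mem_antidiagonal] at hq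
    by_contra hc
    have h1 := hG _ _ (left_ne_zero_of_mul hc)
    simp only at hq h1 hp
    have hp2 : 0 < p2 := by
      rcases Nat.eq_zero_or_pos p2 with h0 | h0
      · exact absurd (by simp [h0] at hp ⊢; exact hp) hne
      · exact h0
    nlinarith
  · simp

open PowerSeries Polynomial in
theorem exists_weierstrass (f : PS K) {n α β N : ℕ} (hα : 0 < α) (hβ : 0 < β)
    (hn : coef K f (0, n) ≠ 0) (hlt : ∀ b < n, coef K f (0, b) = 0)
    (hN : ∀ p, coef K f p ≠ 0 → N ≤ α * p.1 + β * p.2) :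
    ∃ (W : K⟦X⟧[X]) (h : K⟦X⟧⟦X⟧),
      (toIter f).IsWeierstrassFactorization W h ∧ W.natDegree = n ∧
      (∀ a b, PowerSeries.coeff a (W.coeff b) ≠ 0 → N ≤ α * a + β * b) ∧
      ∃ c : K, c ≠ 0 ∧ ∀ a b, α * a + β * b = N →
        PowerSeries.coeff a (W.coeff b) = c * coef K f (a, b) := by
  have hres : ∀ b, IsLocalRing.residue K⟦X⟧ (PowerSeries.coeff b (toIter f)) = 0 ↔
      coef K f (0, b) = 0 := by
    intro b
    rw [IsLocalRing.residue_eq_zero_iff, PowerSeries.maximalIdeal_eq_span_X,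
      Ideal.mem_span_singleton, PowerSeries.X_dvd_iff, ← coeff_toIter,
      PowerSeries.coeff_zero_eq_constantCoeff]
  have horder : ((toIter f).map (IsLocalRing.residue K⟦X⟧)).order = n := by
    rw [PowerSeries.order_eq_nat]
    refine ⟨?_, fun i hi => ?_⟩
    · rw [PowerSeries.coeff_map, Ne, hres]; exact hn
    · rw [PowerSeries.coeff_map, hres]; exact hlt i hi
  have hne : (toIter f).map (IsLocalRing.residue K⟦X⟧) ≠ 0 := by
    intro h0
    rw [h0, PowerSeries.order_zero] at horder
    exact absurd horder.symm (ENat.natCast_ne_top n)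
  obtain ⟨W, h, H⟩ := PowerSeries.exists_isWeierstrassFactorization hne
  refine ⟨W, h, H, ?_, ?_⟩
  · rw [PowerSeries.IsWeierstrassFactorization.natDegree_eq_toNat_order_map H, horder]; simp
  obtain ⟨u, hu⟩ := H.isUnit
  have hW : (W : K⟦X⟧⟦X⟧) = toIter f * ↑(u⁻¹) := by
    rw [H.eq_mul, ← hu, mul_assoc, Units.mul_inv, mul_one]
  have hG : ∀ a b, PowerSeries.coeff a (PowerSeries.coeff b (toIter f)) ≠ 0 →
      N ≤ α * a + β * b := fun a b hab => by
    rw [coeff_toIter] at hab; exact hN _ hab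
  refine ⟨fun a b hab => ?_, PowerSeries.coeff 0 (PowerSeries.coeff 0 (↑(u⁻¹) : K⟦X⟧⟦X⟧)), ?_,
    fun a b hab => ?_⟩
  · rw [← Polynomial.coeff_coe, hW] at hab
    exact weight_le_of_mul hG _ _ _ hab
  · have h1 := (((u⁻¹).isUnit.map (PowerSeries.constantCoeff (R := K⟦X⟧))).map
      (PowerSeries.constantCoeff (R := K)))
    simpa using h1.ne_zero
  · rw [← Polynomial.coeff_coe, hW, coeff_mul_of_weight_eq hα hβ hG _ _ _ hab, coeff_toIter,
      mul_comm]

end IteratedSeries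

section Weights

open Polynomial

theorem hahnSeries_coeff_mul_of_vanish {R : Type*} [CommRing R] {x y : HahnSeries ℤ R} {k l : ℤ}
    (hx : ∀ j < k, x.coeff j = 0) (hy : ∀ j < l, y.coeff j = 0) :
    (∀ j < k + l, (x * y).coeff j = 0) ∧ (x * y).coeff (k + l) = x.coeff k * y.coeff l := by
  have key : ∀ i j : ℤ, i + j ≤ k + l → (i, j) ≠ (k, l) → x.coeff i * y.coeff j = 0 := by
    intro i j hij hne
    rcases lt_or_ge i k with h | h
    · rw [hx i h, zero_mul]
    · rcases lt_or_ge j l with h' | h'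
      · rw [hy j h', mul_zero]
      · exact absurd (Prod.ext (by dsimp; omega) (by dsimp; omega)) hne
  refine ⟨fun j hj => ?_, ?_⟩
  · rw [HahnSeries.coeff_mul]
    refine Finset.sum_eq_zero fun p hp => ?_
    rw [Finset.mem_antidiagonal] at hp
    refine key p.1 p.2 (by omega) fun h => ?_
    have h1 := congrArg Prod.fst h
    have h2 := congrArg Prod.snd h
    dsimp at h1 h2
    omega
  · rw [HahnSeries.coeff_mul]
    by_cases hkl : x.coeff k * y.coeff l = 0
    · rw [hkl]
      refine Finset.sum_eq_zero fun p hp => ?_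
      rw [Finset.mem_antidiagonal] at hp
      by_cases h : p = (k, l)
      · rw [h]; exact hkl
      · exact key p.1 p.2 hp.2.2.le h
    · refine (Finset.sum_eq_single (k, l) (fun p hp hne => ?_) fun h => ?_)
      · rw [Finset.mem_antidiagonal] at hp
        exact key p.1 p.2 hp.2.2.le hne
      · exact absurd (Finset.mem_antidiagonal.2
          ⟨left_ne_zero_of_mul hkl, right_ne_zero_of_mul hkl, rfl⟩) h

variable {K : Type u} [Field K] (α β : ℕ) [NeZero α]

/-- Multiplication by `α` as an order embedding of the exponents. -/
def mulEmb : ℤ ↪o ℤ :=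
  OrderEmbedding.ofStrictMono (fun k : ℤ => (α : ℤ) * k) fun _ _ h =>
    mul_lt_mul_of_pos_left h (by exact_mod_cast NeZero.pos α)

/-- The substitution `x ↦ s ^ α` on Laurent series. -/
def substPow : LaurentSeries K →+* LaurentSeries K where
  toFun := HahnSeries.embDomain (mulEmb α)
  map_one' := HahnSeries.embDomain_one _ (mul_zero _)
  map_mul' := HahnSeries.embDomain_mul _ (mul_add _)
  map_zero' := HahnSeries.embDomain_zero
  map_add' := HahnSeries.embDomain_add _

/-- The substitution `x ↦ s ^ α` on Laurent series, followed by the inclusion of constants. -/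
def scaleHom : LaurentSeries K →+* LaurentSeries K[X] :=
  RingHom.comp
    { toFun := fun x => x.map (C : K →+* K[X])
      map_one' := by
        ext k
        rw [HahnSeries.map_coeff, HahnSeries.coeff_one, HahnSeries.coeff_one]
        split_ifs <;> simp
      map_mul' := fun x y => HahnSeries.map_mul (C : K →+* K[X]).toNonUnitalRingHom
      map_zero' := by ext k; simp
      map_add' := fun x y => by ext k; simp } (substPow α)

theorem scaleHom_coeff (x : LaurentSeries K) (k : ℤ) :
    (scaleHom α x).coeff k = if (α : ℤ) ∣ k then C (x.coeff (k / α)) else 0 := by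
  have hα : (α : ℤ) ≠ 0 := by exact_mod_cast NeZero.ne α
  change C ((HahnSeries.embDomain (mulEmb α) x).coeff k) = _
  split_ifs with h
  · obtain ⟨j, rfl⟩ := h
    rw [Int.mul_ediv_cancel_left _ hα]
    exact congrArg C (HahnSeries.embDomain_coeff (f := mulEmb α) (a := j))
  · rw [HahnSeries.embDomain_of_notMem_range, map_zero]
    rintro ⟨j, rfl⟩
    exact h (Dvd.intro _ rfl)

/-- The ring homomorphism `x ↦ s ^ α`, `y ↦ s ^ β u`, whose target records weights. -/
def weightHom : (LaurentSeries K)[X] →+* LaurentSeries K[X] :=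
  eval₂RingHom (scaleHom α) (HahnSeries.single (β : ℤ) X)

theorem coeff_weightHom (P : (LaurentSeries K)[X]) (k : ℤ) (b : ℕ) :
    ((weightHom α β P).coeff k).coeff b =
      if (α : ℤ) ∣ k - β * b then (P.coeff b).coeff ((k - β * b) / α) else 0 := by
  induction P using Polynomial.induction_on' with
  | add P Q hP hQ =>
    rw [map_add, HahnSeries.coeff_add, Polynomial.coeff_add, hP, hQ, Polynomial.coeff_add]
    split_ifs
    · rw [HahnSeries.coeff_add]
    · rw [add_zero]
  | monomial i c =>
    rw [weightHom, coe_eval₂RingHom, eval₂_monomial, HahnSeries.single_pow,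
      HahnSeries.coeff_mul_single, scaleHom_coeff, coeff_monomial]
    rw [nsmul_eq_mul, mul_comm (i : ℤ)]
    by_cases hi : i = b
    · subst hi
      rw [if_pos rfl]
      split_ifs <;> simp
    · rw [if_neg hi]
      split_ifs <;> simp [coeff_X_pow, Ne.symm hi]

/-- All monomials `x ^ a y ^ b` of `P` have weight `α a + β b` at least `k`. -/
def WGe (k : ℤ) (P : (LaurentSeries K)[X]) : Prop := ∀ j < k, (weightHom α β P).coeff j = 0

/-- The part of weight `k` of `P`, dehomogenized. -/
def sym (k : ℤ) (P : (LaurentSeries K)[X]) : K[X] := (weightHom α β P).coeff k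

variable {α β}

theorem coeff_sym (P : (LaurentSeries K)[X]) (a : ℤ) (b : ℕ) :
    (sym α β (α * a + β * b) P).coeff b = (P.coeff b).coeff a := by
  have hα : (α : ℤ) ≠ 0 := by exact_mod_cast NeZero.ne α
  rw [sym, coeff_weightHom, add_sub_cancel_right, if_pos (Dvd.intro _ rfl),
    Int.mul_ediv_cancel_left _ hα]

theorem coeff_sym_of_not_dvd (P : (LaurentSeries K)[X]) {k : ℤ} {b : ℕ}
    (h : ¬ (α : ℤ) ∣ k - β * b) : (sym α β k P).coeff b = 0 := by
  rw [sym, coeff_weightHom, if_neg h]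

theorem exists_of_coeff_sym_ne_zero {P : (LaurentSeries K)[X]} {k : ℤ} {b : ℕ}
    (h : (sym α β k P).coeff b ≠ 0) : ∃ a : ℤ, k = α * a + β * b ∧ (P.coeff b).coeff a ≠ 0 := by
  by_cases hd : (α : ℤ) ∣ k - β * b
  · obtain ⟨a, ha⟩ := hd
    have hk : k = α * a + β * b := by linarith
    subst hk
    exact ⟨a, rfl, by rwa [coeff_sym] at h⟩
  · exact absurd (coeff_sym_of_not_dvd P hd) h

theorem wge_iff {k : ℤ} {P : (LaurentSeries K)[X]} :
    WGe α β k P ↔ ∀ (b : ℕ) (a : ℤ), (P.coeff b).coeff a ≠ 0 → k ≤ α * a + β * b := by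
  constructor
  · intro h b a hab
    by_contra hlt
    rw [← coeff_sym (α := α) (β := β), sym, h _ (not_le.1 hlt)] at hab
    exact hab rfl
  · intro h j hj
    ext b
    by_contra hc
    obtain ⟨a, rfl, ha⟩ := exists_of_coeff_sym_ne_zero (α := α) (β := β) (P := P) (k := j) hc
    exact absurd (h b a ha) (not_le.2 hj)

theorem weightHom_injective : Function.Injective (weightHom (K := K) α β) := by
  rw [injective_iff_map_eq_zero]
  intro P hP
  ext b a
  rw [← coeff_sym (α := α) (β := β), sym, hP]
  simp

theorem WGe.mul {k l : ℤ} {P Q : (LaurentSeries K)[X]} (hP : WGe α β k P) (hQ : WGe α β l Q) :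
    WGe α β (k + l) (P * Q) := by
  intro j hj
  rw [map_mul]
  exact (hahnSeries_coeff_mul_of_vanish hP hQ).1 j hj

theorem sym_mul {k l : ℤ} {P Q : (LaurentSeries K)[X]} (hP : WGe α β k P) (hQ : WGe α β l Q) :
    sym α β (k + l) (P * Q) = sym α β k P * sym α β l Q := by
  rw [sym, map_mul]
  exact (hahnSeries_coeff_mul_of_vanish hP hQ).2

theorem WGe.add {k : ℤ} {P Q : (LaurentSeries K)[X]} (hP : WGe α β k P) (hQ : WGe α β k Q) :
    WGe α β k (P + Q) := by
  intro j hj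
  rw [map_add, HahnSeries.coeff_add, hP j hj, hQ j hj, add_zero]

theorem sym_add (k : ℤ) (P Q : (LaurentSeries K)[X]) :
    sym α β k (P + Q) = sym α β k P + sym α β k Q := by
  simp [sym]

theorem sym_sub (k : ℤ) (P Q : (LaurentSeries K)[X]) :
    sym α β k (P - Q) = sym α β k P - sym α β k Q := by
  simp [sym]

theorem WGe.mono {k l : ℤ} (h : l ≤ k) {P : (LaurentSeries K)[X]} (hP : WGe α β k P) :
    WGe α β l P := fun j hj => hP j (hj.trans_le h)

theorem WGe.sym_eq_zero {k l : ℤ} (h : l < k) {P : (LaurentSeries K)[X]} (hP : WGe α β k P) :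
    sym α β l P = 0 := hP l h

theorem WGe.zero (k : ℤ) : WGe α β k (0 : (LaurentSeries K)[X]) := by
  intro j hj
  simp

theorem WGe.one : WGe α β 0 (1 : (LaurentSeries K)[X]) := by
  intro j hj
  rw [map_one, HahnSeries.coeff_one, if_neg hj.ne]

theorem sym_one : sym α β 0 (1 : (LaurentSeries K)[X]) = 1 := by
  rw [sym, map_one, HahnSeries.coeff_one, if_pos rfl]

theorem exists_exact_weight {P : (LaurentSeries K)[X]} (hP : P ≠ 0) :
    ∃ k : ℤ, WGe α β k P ∧ sym α β k P ≠ 0 := by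
  have h : weightHom α β P ≠ 0 := fun h => hP (weightHom_injective (by rw [h, map_zero]))
  exact ⟨(weightHom α β P).order, fun j hj => HahnSeries.coeff_eq_zero_of_lt_order hj,
    HahnSeries.coeff_order_eq_zero.not.2 h⟩

theorem le_of_exact_weight {k l : ℤ} {P : (LaurentSeries K)[X]} (hk : sym α β k P ≠ 0)
    (hl : WGe α β l P) : l ≤ k := by
  by_contra h
  exact hk (hl k (not_le.1 h))

theorem WGe.of_mul {k l : ℤ} {P G : (LaurentSeries K)[X]} (hG : WGe α β l G)
    (hG' : sym α β l G ≠ 0) (h : WGe α β (k + l) (P * G)) : WGe α β k P := by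
  by_cases hP : P = 0
  · rw [hP]; exact WGe.zero k
  obtain ⟨i, hi, hi'⟩ := exists_exact_weight (α := α) (β := β) hP
  refine hi.mono ?_
  have := le_of_exact_weight (k := i + l) (P := P * G)
    (by rw [sym_mul hi hG]; exact mul_ne_zero hi' hG') h
  omega

theorem degree_sym_lt {k : ℤ} {P : (LaurentSeries K)[X]} {n : ℕ} (h : P.degree < n) :
    (sym α β k P).degree < n := by
  rw [degree_lt_iff_coeff_zero] at h ⊢
  intro b hb
  by_contra hc
  obtain ⟨a, -, ha⟩ := exists_of_coeff_sym_ne_zero hc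
  rw [h b hb] at ha
  exact ha rfl

theorem coeff_sym_natDegree_of_monic {G : (LaurentSeries K)[X]} (hG : G.Monic) :
    (sym α β (β * G.natDegree) G).coeff G.natDegree = 1 := by
  have h := coeff_sym (α := α) (β := β) G 0 G.natDegree
  rw [mul_zero, zero_add] at h
  rw [h, hG.coeff_natDegree, HahnSeries.coeff_one, if_pos rfl]

theorem sym_ne_zero_of_monic {G : (LaurentSeries K)[X]} (hG : G.Monic) :
    sym α β (β * G.natDegree) G ≠ 0 := by
  intro h
  have := coeff_sym_natDegree_of_monic (α := α) (β := β) hG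
  rw [h] at this
  simp at this

theorem degree_sym_of_monic {G : (LaurentSeries K)[X]} (hG : G.Monic) :
    (sym α β (β * G.natDegree) G).degree = G.natDegree := by
  refine le_antisymm ?_ (le_degree_of_ne_zero
    (by rw [coeff_sym_natDegree_of_monic hG]; exact one_ne_zero))
  rw [degree_le_iff_coeff_zero]
  intro b hb
  by_contra hc
  obtain ⟨a, -, ha⟩ := exists_of_coeff_sym_ne_zero hc
  rw [coeff_eq_zero_of_natDegree_lt (by exact_mod_cast hb)] at ha
  exact ha rfl

theorem WGe.modByMonic {k : ℤ} {P G : (LaurentSeries K)[X]} (hG : G.Monic)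
    (hGw : WGe α β (β * G.natDegree) G) (hP : WGe α β k P) : WGe α β k (P %ₘ G) := by
  by_cases hr : P %ₘ G = 0
  · rw [hr]; exact WGe.zero k
  by_cases hq : P /ₘ G = 0
  · have := modByMonic_add_div P G
    rw [hq, mul_zero, add_zero] at this
    rwa [this]
  obtain ⟨j, hj, hj'⟩ := exists_exact_weight (α := α) (β := β) hr
  obtain ⟨i, hi, hi'⟩ := exists_exact_weight (α := α) (β := β) hq
  have hGs := sym_ne_zero_of_monic (α := α) (β := β) hG
  have hmul := hGw.mul hi
  have hsm := sym_mul hGw hi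
  have hsum := modByMonic_add_div P G
  set t : ℤ := β * G.natDegree + i with ht
  refine hj.mono ?_
  by_contra hlt
  rw [not_le] at hlt
  rcases lt_or_ge j t with hjt | hjt
  · have h1 := hP.sym_eq_zero hlt
    rw [← hsum, sym_add, hmul.sym_eq_zero hjt, add_zero] at h1
    exact hj' h1
  · have h1 := hP.sym_eq_zero (lt_of_le_of_lt hjt hlt)
    rw [← hsum, sym_add, hsm, add_comm, add_eq_zero_iff_eq_neg] at h1
    have hdeg : (sym α β t (P %ₘ G)).degree < G.natDegree :=
      degree_sym_lt ((degree_modByMonic_lt P hG).trans_le degree_le_natDegree)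
    rw [← degree_neg, ← h1, degree_mul, degree_sym_of_monic hG] at hdeg
    have h0 : (0 : WithBot ℕ) ≤ (sym α β i (P /ₘ G)).degree := zero_le_degree_iff.2 hi'
    exact absurd hdeg (not_lt.2 (le_add_of_nonneg_right h0))

end Weights

section WeightOrder

open Polynomial
open scoped PowerSeries

variable {K : Type u} [Field K]

theorem coeff_algebraMap_laurentSeries (s : K⟦X⟧) (a : ℤ) :
    (algebraMap K⟦X⟧ (LaurentSeries K) s).coeff a =
      if a < 0 then 0 else PowerSeries.coeff a.natAbs s :=
  PowerSeries.coeff_coe s a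

theorem exists_algebraMap_eq_of_coeff_eq_zero {q : LaurentSeries K}
    (hq : ∀ a < 0, q.coeff a = 0) : ∃ s : K⟦X⟧, algebraMap K⟦X⟧ (LaurentSeries K) s = q := by
  refine ⟨PowerSeries.mk fun i => q.coeff i, ?_⟩
  ext a
  rw [coeff_algebraMap_laurentSeries]
  split_ifs with h
  · rw [hq a h]
  · rw [PowerSeries.coeff_mk, Int.natAbs_of_nonneg (not_lt.1 h)]

/-- The polynomial `W` over Laurent series. -/
abbrev toLaurent (W : K⟦X⟧[X]) : (LaurentSeries K)[X] :=
  W.map (algebraMap K⟦X⟧ (LaurentSeries K))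

theorem wge_toLaurent_iff {α β : ℕ} [NeZero α] {N : ℕ} {W : K⟦X⟧[X]} :
    WGe α β N (toLaurent W) ↔
      ∀ a b, PowerSeries.coeff a (W.coeff b) ≠ 0 → N ≤ α * a + β * b := by
  rw [wge_iff]
  constructor
  · intro h a b hab
    have := h b a (by rw [coeff_map, coeff_algebraMap_laurentSeries]; simpa using hab)
    exact_mod_cast this
  · intro h b a hab
    rw [coeff_map, coeff_algebraMap_laurentSeries] at hab
    split_ifs at hab with ha
    · exact absurd rfl hab
    · obtain ⟨c, rfl⟩ := Int.eq_ofNat_of_zero_le (not_lt.1 ha)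
      exact_mod_cast h c b (by simpa using hab)

theorem coeff_sym_toLaurent {α β : ℕ} [NeZero α] (W : K⟦X⟧[X]) (a b : ℕ) :
    (sym α β (α * a + β * b : ℕ) (toLaurent W)).coeff b = PowerSeries.coeff a (W.coeff b) := by
  have := coeff_sym (α := α) (β := β) (toLaurent W) a b
  push_cast
  rw [this, coeff_map, coeff_algebraMap_laurentSeries]
  simp

theorem wge_toLaurent_zero {α β : ℕ} [NeZero α] (W : K⟦X⟧[X]) :
    WGe α β 0 (toLaurent W) := by
  have := (wge_toLaurent_iff (α := α) (β := β) (N := 0) (W := W)).2 (fun _ _ _ => Nat.zero_le _)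
  exact_mod_cast this

/-- The algebra `K((x))[y]/(W)`. -/
abbrev CurveAlg (W : K⟦X⟧[X]) := AdjoinRoot (toLaurent W)

variable {W : K⟦X⟧[X]} (hW : W.Monic)

/-- The representative of degree `< deg W`. -/
def rep : CurveAlg W →ₗ[LaurentSeries K] (LaurentSeries K)[X] :=
  AdjoinRoot.modByMonicHom (hW.map (algebraMap K⟦X⟧ (LaurentSeries K)))

theorem mk_rep (z : CurveAlg W) : AdjoinRoot.mk (toLaurent W) (rep hW z) = z :=
  AdjoinRoot.mk_leftInverse _ z

theorem rep_mk (P : (LaurentSeries K)[X]) :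
    rep hW (AdjoinRoot.mk (toLaurent W) P) = P %ₘ toLaurent W :=
  AdjoinRoot.modByMonicHom_mk _ P

include hW in
theorem natDegree_toLaurent : (toLaurent W).natDegree = W.natDegree :=
  hW.natDegree_map _

theorem degree_rep_lt (z : CurveAlg W) : (rep hW z).degree < W.natDegree := by
  rw [← mk_rep hW z, rep_mk, ← natDegree_toLaurent hW]
  exact (degree_modByMonic_lt _ (hW.map _)).trans_le degree_le_natDegree

theorem rep_mk_of_degree_lt {P : (LaurentSeries K)[X]} (hP : P.degree < W.natDegree) :
    rep hW (AdjoinRoot.mk (toLaurent W) P) = P := by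
  rw [rep_mk, modByMonic_eq_self_iff (hW.map _), degree_eq_natDegree (hW.map _).ne_zero,
    natDegree_toLaurent hW]
  exact hP

theorem rep_mul (z w : CurveAlg W) : rep hW (z * w) = (rep hW z * rep hW w) %ₘ toLaurent W := by
  rw [← rep_mk hW, map_mul (AdjoinRoot.mk _), mk_rep, mk_rep]

theorem rep_algebraMap (s : K⟦X⟧) :
    rep hW (algebraMap K⟦X⟧ (CurveAlg W) s) = (toLaurent (C s)) %ₘ toLaurent W := by
  rw [← rep_mk hW]
  congr 1
  exact (congrArg (AdjoinRoot.mk (toLaurent W)) (map_C _)).symm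

variable {α β : ℕ} [NeZero α] (hw : WGe α β (β * W.natDegree) (toLaurent W))

include hW hw in
theorem wge_modByMonic_toLaurent {k : ℤ} {P : (LaurentSeries K)[X]} (hP : WGe α β k P) :
    WGe α β k (P %ₘ toLaurent W) :=
  WGe.modByMonic (hW.map _) (by rwa [natDegree_toLaurent hW]) hP

include hW hw in
theorem wge_rep_mul {k l : ℤ} {z w : CurveAlg W} (hz : WGe α β k (rep hW z))
    (hz' : WGe α β l (rep hW w)) : WGe α β (k + l) (rep hW (z * w)) := by
  rw [rep_mul]
  exact wge_modByMonic_toLaurent hW hw (hz.mul hz')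

include hW in
theorem sym_toLaurent_ne_zero : sym α β (β * W.natDegree) (toLaurent W) ≠ 0 := by
  rw [← natDegree_toLaurent hW]
  exact sym_ne_zero_of_monic (hW.map _)

include hW in
theorem degree_sym_toLaurent :
    (sym α β (β * W.natDegree) (toLaurent W)).degree = W.natDegree := by
  rw [← natDegree_toLaurent hW]
  exact degree_sym_of_monic (hW.map _)

include hW hw in
theorem sym_dvd_sym_modByMonic {k : ℤ} {P : (LaurentSeries K)[X]} (hP : WGe α β k P) :
    sym α β (β * W.natDegree) (toLaurent W) ∣
      sym α β k P - sym α β k (P %ₘ toLaurent W) := by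
  have h1 := modByMonic_add_div P (toLaurent W)
  have h2 : WGe α β k (P /ₘ toLaurent W * toLaurent W) := by
    have h3 : P /ₘ toLaurent W * toLaurent W = P + (-1) * (P %ₘ toLaurent W) := by
      linear_combination h1
    rw [h3]
    refine hP.add ?_
    have hone : WGe α β 0 (-1 : (LaurentSeries K)[X]) := by
      intro j hj
      rw [map_neg, HahnSeries.coeff_neg, WGe.one j hj, neg_zero]
    simpa only [zero_add] using hone.mul (wge_modByMonic_toLaurent hW hw hP)
  have h3 : WGe α β (k - β * W.natDegree) (P /ₘ toLaurent W) :=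
    WGe.of_mul hw (sym_toLaurent_ne_zero hW) (by simpa using h2)
  refine ⟨sym α β (k - β * W.natDegree) (P /ₘ toLaurent W), ?_⟩
  rw [← sym_mul hw h3, ← sym_sub]
  congr 1
  · ring
  · linear_combination -h1

/-- The subring of elements of non-negative weight. -/
def weightOrder : Subalgebra K⟦X⟧ (CurveAlg W) where
  carrier := {z | WGe α β 0 (rep hW z)}
  mul_mem' := fun {z w} hz hz' => by
    have := wge_rep_mul hW hw hz hz'
    rwa [add_zero] at this
  add_mem' := fun {z w} hz hz' => by
    change WGe α β 0 (rep hW (z + w))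
    rw [map_add]
    exact WGe.add hz hz'
  algebraMap_mem' := fun s => by
    change WGe α β 0 (rep hW _)
    rw [rep_algebraMap]
    exact wge_modByMonic_toLaurent hW hw (wge_toLaurent_zero _)

theorem mem_weightOrder {z : CurveAlg W} :
    z ∈ weightOrder hW hw ↔ WGe α β 0 (rep hW z) := Iff.rfl

theorem mk_eq_sum (P : (LaurentSeries K)[X]) :
    AdjoinRoot.mk (toLaurent W) P =
      ∑ b ∈ P.support, P.coeff b • AdjoinRoot.mk (toLaurent W) X ^ b := by
  conv_lhs => rw [P.as_sum_support_C_mul_X_pow]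
  rw [map_sum]
  refine Finset.sum_congr rfl fun b _ => ?_
  rw [map_mul, map_pow, Algebra.smul_def]
  rfl

theorem mem_span_of_coeff_le {N : ℕ} {z : CurveAlg W}
    (hz : ∀ (b : ℕ) (a : ℤ), a < -N → ((rep hW z).coeff b).coeff a = 0) :
    z ∈ Submodule.span K⟦X⟧ (Set.range fun b : Fin W.natDegree =>
      (HahnSeries.single (-N : ℤ) (1 : K) : LaurentSeries K) •
        AdjoinRoot.mk (toLaurent W) X ^ (b : ℕ)) := by
  rw [← mk_rep hW z, mk_eq_sum (rep hW z)]
  refine sum_mem fun b hb => ?_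
  obtain ⟨s, hs⟩ := exists_algebraMap_eq_of_coeff_eq_zero
    (q := HahnSeries.single (N : ℤ) (1 : K) * (rep hW z).coeff b) (fun a ha => by
      rw [HahnSeries.coeff_single_mul, one_mul]
      exact hz b _ (by omega))
  have hq : (rep hW z).coeff b =
      algebraMap K⟦X⟧ (LaurentSeries K) s * HahnSeries.single (-N : ℤ) (1 : K) := by
    rw [hs, mul_right_comm, HahnSeries.single_mul_single, add_neg_cancel, one_mul]
    simp
  rw [hq, mul_smul, algebraMap_smul]
  have hbn : b < W.natDegree := by
    have := (le_degree_of_mem_supp b hb).trans_lt (degree_rep_lt hW z)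
    exact_mod_cast this
  exact Submodule.smul_mem _ _ (Submodule.subset_span ⟨⟨b, hbn⟩, rfl⟩)

instance finite_weightOrder : Module.Finite K⟦X⟧ (weightOrder hW hw) := by
  have hle : Subalgebra.toSubmodule (weightOrder hW hw) ≤
      Submodule.span K⟦X⟧ (Set.range fun b : Fin W.natDegree =>
      (HahnSeries.single (-(β * W.natDegree : ℕ) : ℤ) (1 : K) : LaurentSeries K) •
        AdjoinRoot.mk (toLaurent W) X ^ (b : ℕ)) := by
    intro z hz
    refine mem_span_of_coeff_le hW fun b a ha => ?_
    by_contra hc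
    have h1 := wge_iff.1 ((mem_weightOrder hW hw).1 hz) b a hc
    have h2 : b < W.natDegree := by
      by_contra hb
      rw [coeff_eq_zero_of_degree_lt ((degree_rep_lt hW z).trans_le (by exact_mod_cast not_lt.1 hb))]
        at hc
      exact hc rfl
    have h3 : (1 : ℤ) ≤ α := by exact_mod_cast NeZero.pos α
    have h4 : (b : ℤ) < W.natDegree := by exact_mod_cast h2
    push_cast at ha
    have h5 : (0 : ℤ) ≤ β := by positivity
    have h6 : (β : ℤ) * b ≤ β * W.natDegree := mul_le_mul_of_nonneg_left h4.le h5
    have h7 : (0 : ℤ) ≤ β * W.natDegree := by positivity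
    nlinarith
  have hfg : (Subalgebra.toSubmodule (weightOrder hW hw)).FG :=
    haveI := isNoetherian_span_of_finite K⟦X⟧ (Set.finite_range fun b : Fin W.natDegree =>
      (HahnSeries.single (-(β * W.natDegree : ℕ) : ℤ) (1 : K) : LaurentSeries K) •
        AdjoinRoot.mk (toLaurent W) X ^ (b : ℕ))
    Submodule.FG.of_le (Submodule.fg_span (Set.finite_range _)) hle
  exact Module.Finite.iff_fg.2 hfg

theorem isIntegral_of_mem_weightOrder {z : CurveAlg W} (hz : z ∈ weightOrder hW hw) :
    IsIntegral K⟦X⟧ z :=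
  (Algebra.IsIntegral.isIntegral (R := K⟦X⟧) (⟨z, hz⟩ : weightOrder hW hw)).map
    (weightOrder hW hw).val

end WeightOrder

section CompleteDVR

open IsLocalRing TensorProduct

theorem isPrecomplete_of_finite {A : Type*} [CommRing A] (I : Ideal A) [IsPrecomplete I A]
    {M : Type*} [AddCommGroup M] [Module A M] [Module.Finite A M] : IsPrecomplete I M := by
  rw [← AdicCompletion.of_surjective_iff]
  intro z
  obtain ⟨t, rfl⟩ := AdicCompletion.ofTensorProduct_surjective_of_finite I M z
  induction t with
  | zero => exact ⟨0, by simp⟩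
  | add a b ha hb =>
    obtain ⟨a', ha⟩ := ha
    obtain ⟨b', hb⟩ := hb
    exact ⟨a' + b', by rw [map_add, map_add, ha, hb]⟩
  | tmul a b =>
    obtain ⟨a', rfl⟩ := AdicCompletion.of_surjective I A a
    refine ⟨a' • b, ?_⟩
    rw [AdicCompletion.ofTensorProduct_tmul, map_smul]
    ext n
    rfl

variable {A : Type*} (F : Type*) {L : Type*} [CommRing A] [IsDomain A] [IsDiscreteValuationRing A]
  [Field F] [Algebra A F] [IsFractionRing A F]
  [CommRing L] [Algebra A L] [Algebra F L] [IsScalarTower A F L] [Module.Finite F L]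

include F in
theorem finite_residueField_tensor (N : Submodule A L) :
    Module.Finite (ResidueField A) (ResidueField A ⊗[A] N) := by
  have : Module.IsTorsionFree A L := Module.IsTorsionFree.trans_faithfulSMul A F L
  have hflat : Module.Flat A N := inferInstance
  have hsurj : Function.Surjective (TensorProduct.mk A (ResidueField A) N 1) :=
    TensorProduct.mk_surjective A N (ResidueField A) residue_surjective
  have hle : Module.rank (ResidueField A) (ResidueField A ⊗[A] N) ≤ Module.finrank F L := by
    refine rank_le fun s hs => ?_
    choose v hv using fun i : s => hsurj i
    have h1 : LinearIndependent A v :=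
      Module.IsLocalRing.linearIndependent_of_flat v (by convert hs using 1; ext i; exact hv i)
    have h2 : LinearIndependent A (fun i => (v i : L)) :=
      h1.map' N.subtype (Submodule.ker_subtype _)
    have h3 := (LinearIndependent.iff_fractionRing A F).1 h2
    simpa using h3.fintype_card_le_finrank
  exact Module.rank_lt_aleph0_iff.1 (hle.trans_lt (Cardinal.natCast_lt_aleph0))

include F in
omit [Module.Finite F L] in
theorem not_isIntegral_inv {ϖ : A} (hϖ : ϖ ∈ maximalIdeal A) (h0 : ϖ ≠ 0) [Nontrivial L]
    {w : L} (hw : w * algebraMap A L ϖ = 1) : ¬ IsIntegral A w := by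
  intro hInt
  have hw' : w = algebraMap F L (algebraMap A F ϖ)⁻¹ := by
    have h0' : algebraMap A F ϖ ≠ 0 := by simpa using h0
    have : algebraMap A L ϖ * algebraMap F L (algebraMap A F ϖ)⁻¹ = 1 := by
      rw [IsScalarTower.algebraMap_apply A F L, ← map_mul, mul_inv_cancel₀ h0', map_one]
    calc w = w * (algebraMap A L ϖ * algebraMap F L (algebraMap A F ϖ)⁻¹) := by rw [this, mul_one]
      _ = _ := by rw [← mul_assoc, hw, one_mul]
  rw [hw', isIntegral_algebraMap_iff (algebraMap F L).injective] at hInt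
  obtain ⟨a, ha⟩ := IsIntegrallyClosed.isIntegral_iff.1 hInt
  have h0' : algebraMap A F ϖ ≠ 0 := by simpa using h0
  have h1 : a * ϖ = 1 := by
    apply IsFractionRing.injective A F
    rw [map_mul, ha, inv_mul_cancel₀ h0', map_one]
  exact (mem_maximalIdeal ϖ).1 hϖ (IsUnit.of_mul_eq_one a (by rw [mul_comm, h1]))

include F in
theorem isHausdorff_integralClosure [IsReduced L] :
    IsHausdorff (maximalIdeal A) (integralClosure A L) := by
  have : Module.IsTorsionFree A L := Module.IsTorsionFree.trans_faithfulSMul A F L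
  obtain ⟨ϖ, hϖ⟩ := IsDiscreteValuationRing.exists_irreducible A
  have hmax := hϖ.maximalIdeal_eq
  constructor
  intro z hz
  by_contra hz0
  have hdiv : ∀ k : ℕ, ∃ y : integralClosure A L, ϖ ^ k • y = z := by
    intro k
    have := hz k
    rw [SModEq.zero, hmax, Ideal.span_singleton_pow, Submodule.ideal_span_singleton_smul] at this
    obtain ⟨y, -, hy⟩ := this
    exact ⟨y, hy⟩
  have hzL : (z : L) ∉ nilradical L := by
    rw [nilradical_eq_zero L]; simpa using hz0
  rw [nilradical_eq_sInf, Ideal.mem_sInf] at hzL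
  push Not at hzL
  obtain ⟨J, hJ, hzJ⟩ := hzL
  have hJ : J.IsPrime := hJ
  have : IsArtinianRing L := IsArtinianRing.of_finite F L
  have hJm : J.IsMaximal := IsArtinianRing.isMaximal_of_isPrime J
  let _ := Ideal.Quotient.field J
  have : Module.Finite F (L ⧸ J) := inferInstance
  set zb : L ⧸ J := Ideal.Quotient.mk J z with hzb
  have hzb0 : zb ≠ 0 := fun h => hzJ (Ideal.Quotient.eq_zero_iff_mem.1 h)
  have halg : IsAlgebraic A zb⁻¹ :=
    (IsFractionRing.isAlgebraic_iff A F (L ⧸ J)).2 (Algebra.IsAlgebraic.isAlgebraic _)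
  obtain ⟨c, hc0, hc⟩ := halg.exists_integral_multiple
  obtain ⟨j, u, rfl⟩ := IsDiscreteValuationRing.eq_unit_mul_pow_irreducible hc0 hϖ
  have hc : IsIntegral A (ϖ ^ j • zb⁻¹) := by
    have := hc.smul (↑u⁻¹ : A)
    rwa [smul_smul, ← mul_assoc, Units.inv_mul, one_mul] at this
  obtain ⟨y, hy⟩ := hdiv (j + 1)
  have hyint : IsIntegral A (Ideal.Quotient.mk J (y : L)) :=
    (show IsIntegral A (y : L) from y.2).map (Ideal.Quotient.mkₐ A J)
  have hzy : zb = algebraMap A (L ⧸ J) ϖ ^ (j + 1) * Ideal.Quotient.mk J (y : L) := by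
    rw [hzb, ← hy]
    rw [IsScalarTower.algebraMap_apply A L (L ⧸ J), Ideal.Quotient.algebraMap_eq, ← map_pow,
      ← map_pow, ← map_mul, ← Algebra.smul_def]
    rfl
  refine not_isIntegral_inv F (L := L ⧸ J) (hmax ▸ Ideal.mem_span_singleton_self ϖ) hϖ.ne_zero ?_
    (hc.mul hyint)
  calc _ = zb⁻¹ * (algebraMap A (L ⧸ J) ϖ ^ (j + 1) * Ideal.Quotient.mk J (y : L)) := by
        rw [Algebra.smul_def, map_pow]; ring
    _ = 1 := by rw [← hzy, inv_mul_cancel₀ hzb0]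

include F in
theorem finite_integralClosure [IsReduced L] [IsAdicComplete (maximalIdeal A) A] :
    Module.Finite A (integralClosure A L) := by
  have hH := isHausdorff_integralClosure (A := A) F (L := L)
  have hf := finite_residueField_tensor (A := A) F (Subalgebra.toSubmodule (integralClosure A L))
  have hf1 : Module.Finite A (ResidueField A ⊗[A] (integralClosure A L)) :=
    Module.Finite.trans (ResidueField A) _
  have hf2 : Module.Finite A (integralClosure A L ⧸
      ((maximalIdeal A) • ⊤ : Submodule A (integralClosure A L))) :=
    @Module.Finite.equiv A ((A ⧸ maximalIdeal A) ⊗[A] (integralClosure A L)) _ _ _ _ _ _ hf1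
      (quotTensorEquivQuotSMul (integralClosure A L) (maximalIdeal A))
  obtain ⟨n, g, hg⟩ := Module.Finite.exists_fin' A (integralClosure A L ⧸
      ((maximalIdeal A) • ⊤ : Submodule A (integralClosure A L)))
  obtain ⟨h, hh⟩ := Module.projective_lifting_property
    (Submodule.mkQ ((maximalIdeal A) • ⊤ : Submodule A (integralClosure A L))) g
    (Submodule.mkQ_surjective _)
  have : IsPrecomplete (maximalIdeal A) (Fin n → A) := isPrecomplete_of_finite _
  have := surjective_of_mkQ_comp_surjective (I := maximalIdeal A) (f := h) (by rwa [hh])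
  exact Module.Finite.of_surjective h this

end CompleteDVR

section FiniteDomain

open IsLocalRing Polynomial

variable {A B : Type*} [CommRing A] [IsLocalRing A] [IsNoetherianRing A]
  [IsAdicComplete (maximalIdeal A) A] [CommRing B] [IsDomain B] [Algebra A B] [Module.Finite A B]

omit [IsDomain B] in
theorem isAdicComplete_map_of_finite :
    IsAdicComplete ((maximalIdeal A).map (algebraMap A B)) B := by
  rw [IsAdicComplete.map_algebraMap_iff]
  have : IsPrecomplete (maximalIdeal A) B := isPrecomplete_of_finite _
  exact {}

omit [IsNoetherianRing A] [IsAdicComplete (maximalIdeal A) A] [IsDomain B] in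
theorem isArtinianRing_quotient_map :
    IsArtinianRing (B ⧸ (maximalIdeal A).map (algebraMap A B)) := by
  let _ := Ideal.Quotient.field (maximalIdeal A)
  have : Module.Finite (A ⧸ maximalIdeal A) (B ⧸ (maximalIdeal A).map (algebraMap A B)) :=
    Module.Finite.of_restrictScalars_finite A _ _
  exact IsArtinianRing.of_finite (A ⧸ maximalIdeal A) _

/-- A domain finite over a complete local ring is local: no element is zero at one point of the
special fibre and nonzero at another. -/
theorem eval_ne_zero_of_eval_ne_zero {k : Type*} [Field k] (e₁ e₂ : B →+* k)
    (h₁ : ∀ a ∈ maximalIdeal A, e₁ (algebraMap A B a) = 0)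
    (h₂ : ∀ a ∈ maximalIdeal A, e₂ (algebraMap A B a) = 0) {q : B} (hq : e₂ q ≠ 0) :
    e₁ q ≠ 0 := by
  intro hq1
  set I := (maximalIdeal A).map (algebraMap A B) with hI
  have hI1 : ∀ b ∈ I, e₁ b = 0 := fun b hb =>
    (Ideal.map_le_iff_le_comap.2 fun a ha => RingHom.mem_ker.2 (h₁ a ha) : I ≤ RingHom.ker e₁) hb
  have hI2 : ∀ b ∈ I, e₂ b = 0 := fun b hb =>
    (Ideal.map_le_iff_le_comap.2 fun a ha => RingHom.mem_ker.2 (h₂ a ha) : I ≤ RingHom.ker e₂) hb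
  have := isAdicComplete_map_of_finite (A := A) (B := B)
  have := isArtinianRing_quotient_map (A := A) (B := B)
  have hhens : HenselianRing B I := inferInstance
  obtain ⟨n, yb, hy⟩ := IsArtinian.exists_pow_succ_smul_dvd (Ideal.Quotient.mk I q) (1 : B ⧸ I)
  obtain ⟨y, rfl⟩ := Ideal.Quotient.mk_surjective yb
  have hy' : q ^ n * (1 - q * y) ∈ I := by
    rw [← Ideal.Quotient.eq_zero_iff_mem]
    simp only [smul_eq_mul, mul_one, Nat.succ_eq_add_one] at hy
    simp only [map_mul, map_pow, map_sub, map_one]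
    linear_combination -hy
  have hqy : e₂ (q * y) = 1 := by
    have h := hI2 _ hy'
    rw [map_mul, map_pow, map_sub, map_one] at h
    rcases mul_eq_zero.1 h with h | h
    · exact absurd (eq_zero_of_pow_eq_zero h) hq
    · exact (sub_eq_zero.1 h).symm
  set e := (q * y) ^ (n + 1) with he
  have hdvd : e - e * e ∈ I := by
    obtain ⟨c, hc⟩ : (1 - q * y) ∣ 1 - (q * y) ^ (n + 1) := by
      simpa using sub_dvd_pow_sub_pow (1 : B) (q * y) (n + 1)
    have : e - e * e = q ^ n * (1 - q * y) * (c * q * y ^ (n + 1)) := by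
      have h1 : e - e * e = e * (1 - (q * y) ^ (n + 1)) := by rw [he]; ring
      rw [h1, hc, he]; ring
    rw [this]
    exact Ideal.mul_mem_right _ _ hy'
  obtain ⟨a, ha, hae⟩ := hhens.is_henselian (X * (X - 1) : B[X])
    (monic_X.mul (by simpa using monic_X_sub_C (1 : B))) e
    (by simpa [mul_sub] using I.neg_mem hdvd)
    (by
      refine IsUnit.of_mul_eq_one (Ideal.Quotient.mk I (2 * e - 1)) ?_
      rw [← map_mul, ← map_one (Ideal.Quotient.mk I), Ideal.Quotient.eq]
      have : eval e (derivative (X * (X - 1) : B[X])) = 2 * e - 1 := by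
        simp [derivative_mul]; ring
      rw [this]
      have h4 : (2 * e - 1) * (2 * e - 1) - 1 = (-4) * (e - e * e) := by ring
      rw [h4]
      exact I.mul_mem_left _ hdvd)
  have ha' : a * (a - 1) = 0 := by simpa [IsRoot] using ha
  have he1 : e₁ e = 0 := by rw [he, map_pow, map_mul, hq1]; simp
  have he2 : e₂ e = 1 := by rw [he, map_pow, hqy, one_pow]
  have e1a : e₁ a = 0 := by
    have := hI1 _ hae
    rwa [map_sub, he1, sub_zero] at this
  have e2a : e₂ a = 1 := by
    have := hI2 _ hae
    rwa [map_sub, he2, sub_eq_zero] at this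
  rcases mul_eq_zero.1 ha' with h | h
  · rw [h, map_zero] at e2a; exact zero_ne_one e2a
  · rw [sub_eq_zero.1 h, map_one] at e1a; exact one_ne_zero e1a

end FiniteDomain

section Counting

theorem exists_associated_mem_of_irreducible_dvd_prod {R : Type*} [CommRing R] [IsDomain R]
    {p : R} (hp : Irreducible p) (s : Multiset R) (hs : ∀ q ∈ s, Prime q) (h : p ∣ s.prod) :
    ∃ q ∈ s, Associated q p := by
  induction s using Multiset.induction_on with
  | empty => exact absurd (isUnit_of_dvd_one (by simpa using h)) hp.not_isUnit
  | cons q t ih =>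
    rw [Multiset.prod_cons] at h
    obtain ⟨c, hc⟩ := h
    have hq := hs q (Multiset.mem_cons_self q t)
    rcases hq.dvd_or_dvd (hc ▸ dvd_mul_right q t.prod) with h1 | ⟨c', rfl⟩
    · exact ⟨q, Multiset.mem_cons_self q t, hq.irreducible.associated_of_dvd hp h1⟩
    · have : p ∣ t.prod := ⟨c', mul_left_cancel₀ hq.ne_zero (by rw [hc]; ring)⟩
      obtain ⟨r, hr, hrp⟩ := ih (fun r hr => hs r (Multiset.mem_cons_of_mem hr)) this
      exact ⟨r, Multiset.mem_cons_of_mem hr, hrp⟩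

theorem ncard_irreducible_dvd {R : Type*} [CommRing R] [IsDomain R] (s : Multiset R) {f : R}
    (hs : ∀ p ∈ s, Prime p) (hf : Associated f s.prod) (hsq : Squarefree f) :
    Set.ncard {P : Associates R | Irreducible P ∧ P ∣ Associates.mk f} = s.card := by
  have hnd : (s.map Associates.mk).Nodup := by
    rw [Multiset.nodup_iff_le]
    intro a ha
    have hmem : a ∈ s.map Associates.mk := Multiset.mem_of_le ha (by simp)
    obtain ⟨p, hp, rfl⟩ := Multiset.mem_map.1 hmem
    have hd := Multiset.prod_dvd_prod_of_le ha
    rw [Associates.prod_mk, Multiset.prod_cons, Multiset.prod_cons, Multiset.prod_zero, mul_one,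
      ← Associates.mk_mul_mk.symm, Associates.mk_dvd_mk] at hd
    exact (hs p hp).not_isUnit (hsq p (hd.trans hf.symm.dvd))
  have : {P : Associates R | Irreducible P ∧ P ∣ Associates.mk f} =
      (s.map Associates.mk).toFinset := by
    ext P
    obtain ⟨p, rfl⟩ := Associates.mk_surjective P
    simp only [Set.mem_ofPred_eq, Associates.irreducible_mk, Associates.mk_dvd_mk, Finset.mem_coe,
      Multiset.mem_toFinset, Multiset.mem_map]
    constructor
    · rintro ⟨hp, hpf⟩
      obtain ⟨q, hq, hqp⟩ := exists_associated_mem_of_irreducible_dvd_prod hp s hs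
        (hpf.trans hf.dvd)
      exact ⟨q, hq, Associates.mk_eq_mk_iff_associated.2 hqp⟩
    · rintro ⟨q, hq, hqp⟩
      have hqp := Associates.mk_eq_mk_iff_associated.1 hqp
      refine ⟨hqp.irreducible (hs q hq).irreducible, ?_⟩
      exact hqp.symm.dvd.trans ((Multiset.dvd_prod hq).trans hf.symm.dvd)
  rw [this, Set.ncard_coe_finset, Multiset.toFinset_card_of_nodup hnd, Multiset.card_map]

end Counting

section Auxiliary

open Polynomial

theorem div_add_div_reflect {α β d i j : ℕ} (hα : 0 < α) (hcop : Nat.Coprime α β)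
    (hij : i + j = α * d) : β * i / α + β * j / α + (if α ∣ i then 0 else 1) = β * d := by
  have hi := Nat.div_add_mod (β * i) α
  have hj := Nat.div_add_mod (β * j) α
  have hir := Nat.mod_lt (β * i) hα
  have hjr := Nat.mod_lt (β * j) hα
  have hd : α ∣ i ↔ β * i % α = 0 := by
    rw [← Nat.dvd_iff_mod_eq_zero]
    exact ⟨fun h => h.mul_left β, fun h => hcop.dvd_of_dvd_mul_left h⟩
  generalize β * i / α = q at *
  generalize β * j / α = s at *
  generalize β * i % α = r at *
  generalize β * j % α = t at *
  have hsum : α * (q + s) + (r + t) = α * (β * d) := by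
    calc _ = (α * q + r) + (α * s + t) := by ring
      _ = β * (i + j) := by rw [hi, hj]; ring
      _ = _ := by rw [hij]; ring
  have hdv : α ∣ r + t := (Nat.dvd_add_right (dvd_mul_right α (q + s))).1 (hsum ▸ dvd_mul_right _ _)
  obtain ⟨e, he⟩ := hdv
  have h3 : q + s + e = β * d := by
    apply Nat.eq_of_mul_eq_mul_left hα
    rw [← hsum, he]; ring
  have he2 : e < 2 := by
    by_contra h
    have : α * 2 ≤ α * e := Nat.mul_le_mul_left _ (not_lt.1 h)
    omega
  split_ifs with h
  · have hr : r = 0 := hd.1 h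
    have : e = 0 := by
      by_contra h0
      have : α * 1 ≤ α * e := Nat.mul_le_mul_left _ (Nat.one_le_iff_ne_zero.2 h0)
      omega
    omega
  · have hr : r ≠ 0 := fun h' => h (hd.2 h')
    have : e ≠ 0 := by rintro rfl; omega
    omega

theorem two_mul_sum_div {α β d : ℕ} (hα : 0 < α) (hd : 0 < d) (hcop : Nat.Coprime α β) :
    2 * ∑ i ∈ Finset.range (α * d), β * i / α + α * d + β * d = α * d * (β * d) + d := by
  obtain ⟨n, hn⟩ : ∃ n, α * d = n + 1 := Nat.exists_eq_succ_of_ne_zero (by positivity)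
  have h1 : ∑ i ∈ Finset.range (α * d), β * i / α = ∑ e ∈ Finset.range n, β * (e + 1) / α := by
    rw [hn, Finset.sum_range_succ']; simp
  have h2 : ∑ e ∈ Finset.range n, β * (n - e) / α = ∑ e ∈ Finset.range n, β * (e + 1) / α := by
    rw [← Finset.sum_range_reflect (fun e => β * (e + 1) / α)]
    refine Finset.sum_congr rfl fun e he => ?_
    have := Finset.mem_range.1 he
    congr 2
    omega
  have h3 : ∑ e ∈ Finset.range n, (β * (e + 1) / α + β * (n - e) / α +
      (if α ∣ e + 1 then 0 else 1)) = n * (β * d) := by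
    rw [Finset.sum_congr rfl fun e he => div_add_div_reflect (d := d) hα hcop
      (by have := Finset.mem_range.1 he; omega)]
    simp
  have h4 : (∑ e ∈ Finset.range n, if α ∣ e + 1 then 0 else 1) + (d - 1) = n := by
    have h5 : n / α = d - 1 := by
      obtain ⟨d, rfl⟩ : ∃ d', d = d' + 1 := Nat.exists_eq_succ_of_ne_zero hd.ne'
      have h7 : n = (α - 1) + α * d := by
        have : α * (d + 1) = α * d + α := by ring
        omega
      rw [h7, Nat.add_mul_div_left _ _ hα, Nat.div_eq_of_lt (by omega)]; simp
    rw [← h5, ← Nat.card_multiples n α, Finset.card_filter, ← Finset.sum_add_distrib]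
    rw [Finset.sum_congr rfl (g := fun _ => 1) fun e _ => by split_ifs <;> rfl]
    simp
  rw [Finset.sum_add_distrib, Finset.sum_add_distrib, h2] at h3
  rw [h1, hn]
  have : (n + 1) * (β * d) = n * (β * d) + β * d := by ring
  omega

variable {K : Type u} [Field K]

theorem exists_eq_X_pow_mul_expand {α : ℕ} (hα : 0 < α) {c : ℕ} (hc : c < α) {g : K[X]}
    (hg : ∀ b, g.coeff b ≠ 0 → b % α = c) : ∃ ψ : K[X], g = X ^ c * expand K α ψ := by
  obtain ⟨h, hh⟩ : X ^ c ∣ g := X_pow_dvd_iff.2 fun b hb => by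
    by_contra h0
    have := hg b h0
    rw [Nat.mod_eq_of_lt (hb.trans hc)] at this
    omega
  refine ⟨contract α h, ?_⟩
  rw [hh]
  congr 1
  ext b
  rw [coeff_expand hα]
  split_ifs with hb
  · rw [coeff_contract hα.ne', Nat.div_mul_cancel hb]
  · by_contra h0
    have h1 : g.coeff (b + c) ≠ 0 := by rwa [hh, coeff_X_pow_mul]
    have h2 := hg _ h1
    apply hb
    have h3 : b + c ≡ 0 + c [MOD α] := by
      unfold Nat.ModEq; rw [h2, zero_add, Nat.mod_eq_of_lt hc]
    exact (Nat.modEq_zero_iff_dvd).1 (Nat.ModEq.add_right_cancel' c h3)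

theorem dvd_of_expand_dvd_expand {α : ℕ} (hα : 0 < α) {φ χ : K[X]}
    (h : expand K α φ ∣ expand K α χ) : φ ∣ χ := by
  by_cases h0 : φ = 0
  · subst h0
    rw [map_zero, zero_dvd_iff, expand_eq_zero hα] at h
    rw [h]
  have hr : expand K α φ ∣ expand K α (χ % φ) := by
    have h1 : χ % φ = χ - φ * (χ / φ) := by
      rw [eq_sub_iff_add_eq']; exact EuclideanDomain.div_add_mod χ φ
    rw [h1, map_sub, map_mul]
    exact dvd_sub h (dvd_mul_right _ _)
  rw [← EuclideanDomain.mod_eq_zero]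
  by_contra hne
  have hle := natDegree_le_of_dvd hr ((expand_ne_zero hα).2 hne)
  rw [natDegree_expand, natDegree_expand] at hle
  have h2 : φ.natDegree ≤ (χ % φ).natDegree := Nat.le_of_mul_le_mul_right hle hα
  have h3 : (χ % φ).degree < φ.degree := EuclideanDomain.mod_lt χ h0
  have h4 := natDegree_lt_natDegree hne h3
  omega

theorem expand_dvd_of_dvd_sq {α : ℕ} (hα : 0 < α) {c : ℕ} (hc : c < α) {g φ : K[X]}
    (hg : ∀ b, g.coeff b ≠ 0 → b % α = c) (hsq : Squarefree φ) (h0 : φ.coeff 0 ≠ 0)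
    (h : expand K α φ ∣ g * g) : expand K α φ ∣ g := by
  obtain ⟨ψ, rfl⟩ := exists_eq_X_pow_mul_expand hα hc hg
  have hX : IsCoprime (expand K α φ) X := by
    refine ((Polynomial.irreducible_X).coprime_iff_not_dvd.2 fun hd => ?_).symm
    rw [X_dvd_iff, coeff_expand hα] at hd
    simp at hd
    exact h0 hd
  have h1 : expand K α φ ∣ X ^ (c + c) * expand K α (ψ * ψ) := by
    convert h using 1
    rw [map_mul]; ring
  have h2 := (hX.pow_right (n := c + c)).dvd_of_dvd_mul_left h1
  have h3 := dvd_of_expand_dvd_expand hα h2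
  have h4 : φ ∣ ψ := (hsq.dvd_pow_iff_dvd two_ne_zero).1 (by rwa [pow_two])
  exact ((expand K α).toRingHom.map_dvd h4).mul_left _

theorem finrank_le_finrank_quotient {L V : Type*} [AddCommGroup L] [Module K L]
    [AddCommGroup V] [Module K V] {N P B : Submodule K L} (Φ : L →ₗ[K] V) (hBN : B ≤ N)
    (hker : ∀ z ∈ B, Φ z = 0 ↔ z ∈ P) (hsurj : ∀ v, ∃ z ∈ B, Φ z = v)
    [Module.Finite K (N ⧸ P.comap N.subtype)] :
    Module.finrank K V ≤ Module.finrank K (N ⧸ P.comap N.subtype) ∧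
      (N ≤ B → Module.finrank K (N ⧸ P.comap N.subtype) = Module.finrank K V) := by
  have hk : LinearMap.ker (Φ ∘ₗ B.subtype) = P.comap B.subtype := by
    ext z; simpa using hker z z.2
  have hs : Function.Surjective (Φ ∘ₗ B.subtype) := fun v => by
    obtain ⟨z, hz, h⟩ := hsurj v
    exact ⟨⟨z, hz⟩, h⟩
  have e := (Submodule.quotEquivOfEq _ _ hk.symm).trans
    ((Φ ∘ₗ B.subtype).quotKerEquivOfSurjective hs)
  constructor
  · rw [← e.finrank_eq]
    have hle : P.comap B.subtype ≤ (P.comap N.subtype).comap (Submodule.inclusion hBN) :=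
      fun z hz => hz
    refine LinearMap.finrank_le_finrank_of_injective (f := Submodule.mapQ (P.comap B.subtype)
      (P.comap N.subtype) (Submodule.inclusion hBN) hle) ?_
    rw [injective_iff_map_eq_zero]
    intro w hw
    obtain ⟨z, rfl⟩ := Submodule.Quotient.mk_surjective _ w
    rw [Submodule.mapQ_apply, Submodule.Quotient.mk_eq_zero] at hw
    exact (Submodule.Quotient.mk_eq_zero _).2 hw
  · intro h
    obtain rfl := le_antisymm hBN h
    exact e.finrank_eq

theorem finite_quotient_of_ker {L V : Type*} [AddCommGroup L] [Module K L]
    [AddCommGroup V] [Module K V] [Module.Finite K V] {N P : Submodule K L} (Φ : L →ₗ[K] V)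
    (hker : ∀ z ∈ N, Φ z = 0 ↔ z ∈ P) : Module.Finite K (N ⧸ P.comap N.subtype) := by
  have hk : LinearMap.ker (Φ ∘ₗ N.subtype) = P.comap N.subtype := by
    ext z; simpa using hker z z.2
  exact Module.Finite.equiv ((Submodule.quotEquivOfEq _ _ hk.symm).trans
    (Φ ∘ₗ N.subtype).quotKerEquivRange).symm

end Auxiliary

section PolarPart

open Polynomial
open scoped PowerSeries

variable {K : Type u} [Field K] {W : K⟦X⟧[X]}

/-- The canonical map `K[[x]][y]/(W) → K((x))[y]/(W)`. -/
def toCurveAlg (W : K⟦X⟧[X]) : AdjoinRoot W →ₐ[K⟦X⟧] CurveAlg W :=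
  AdjoinRoot.liftAlgHom W (Algebra.ofId K⟦X⟧ (CurveAlg W)) (AdjoinRoot.root (toLaurent W))
    ((eval₂_map (algebraMap K⟦X⟧ (LaurentSeries K)) (AdjoinRoot.of (toLaurent W))
      (AdjoinRoot.root (toLaurent W))).symm.trans (AdjoinRoot.eval₂_root (toLaurent W)))

theorem toCurveAlg_mk (P : K⟦X⟧[X]) :
    toCurveAlg W (AdjoinRoot.mk W P) = AdjoinRoot.mk (toLaurent W) (toLaurent P) := by
  refine (AdjoinRoot.liftAlgHom_mk ..).trans ?_
  rw [← AdjoinRoot.aeval_eq, aeval_def, eval₂_map]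
  rfl

theorem toCurveAlg_injective (hW : W.Monic) : Function.Injective (toCurveAlg W) := by
  rw [injective_iff_map_eq_zero]
  intro b hb
  obtain ⟨P, rfl⟩ := AdjoinRoot.mk_surjective b
  rw [toCurveAlg_mk, AdjoinRoot.mk_eq_zero] at hb
  rw [AdjoinRoot.mk_eq_zero]
  exact (map_dvd_map _ (IsFractionRing.injective K⟦X⟧ (LaurentSeries K)) hW).1 hb

theorem mem_range_toCurveAlg_iff (hW : W.Monic) {z : CurveAlg W} :
    z ∈ (toCurveAlg W).range ↔ ∀ (b : ℕ) (a : ℤ), a < 0 → ((rep hW z).coeff b).coeff a = 0 := by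
  constructor
  · rintro ⟨y, rfl⟩ b a ha
    obtain ⟨P, rfl⟩ := AdjoinRoot.mk_surjective y
    have h : rep hW (toCurveAlg W (AdjoinRoot.mk W P)) = toLaurent (P %ₘ W) := by
      rw [toCurveAlg_mk, rep_mk]
      exact (map_modByMonic _ hW).symm
    change ((rep hW (toCurveAlg W (AdjoinRoot.mk W P))).coeff b).coeff a = 0
    rw [h, coeff_map, coeff_algebraMap_laurentSeries, if_pos ha]
  · intro h
    have hl : rep hW z ∈ Polynomial.lifts (algebraMap K⟦X⟧ (LaurentSeries K)) := by
      rw [lifts_iff_coeff_lifts]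
      exact fun b => exists_algebraMap_eq_of_coeff_eq_zero (h b)
    obtain ⟨P, hP⟩ := (mem_lifts _).1 hl
    refine ⟨AdjoinRoot.mk W P, ?_⟩
    change toCurveAlg W (AdjoinRoot.mk W P) = z
    rw [toCurveAlg_mk]
    exact (congrArg _ hP).trans (mk_rep hW z)

theorem X_pow_smul_mem_range_iff (hW : W.Monic) (J : ℕ) (z : CurveAlg W) :
    (PowerSeries.X ^ J : K⟦X⟧) • z ∈ (toCurveAlg W).range ↔
      ∀ (b : ℕ) (a : ℤ), a < -J → ((rep hW z).coeff b).coeff a = 0 := by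
  have h2 : (PowerSeries.X ^ J : K⟦X⟧) • z =
      (HahnSeries.single (J : ℤ) (1 : K) : LaurentSeries K) • z := by
    rw [← algebraMap_smul (LaurentSeries K) (PowerSeries.X ^ J : K⟦X⟧) z]
    congr 1
    rw [map_pow]
    exact (congrArg (· ^ J) (HahnSeries.ofPowerSeries_X (Γ := ℤ) (R := K))).trans (by simp)
  have h3 : ∀ (b : ℕ) (a : ℤ), ((rep hW ((PowerSeries.X ^ J : K⟦X⟧) • z)).coeff b).coeff (a + J) =
      ((rep hW z).coeff b).coeff a := by
    intro b a
    rw [h2, map_smul, coeff_smul, smul_eq_mul, HahnSeries.coeff_single_mul_add, one_mul]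
  rw [mem_range_toCurveAlg_iff hW]
  constructor
  · intro h b a ha
    rw [← h3]
    exact h b _ (by omega)
  · intro h b a ha
    rw [← sub_add_cancel a (J : ℤ), h3]
    exact h b _ (by omega)

theorem exists_X_pow_smul_mem_range (hW : W.Monic) (z : CurveAlg W) :
    ∃ J : ℕ, (PowerSeries.X ^ J : K⟦X⟧) • z ∈ (toCurveAlg W).range := by
  have hf : ∀ b : ℕ, ∃ J : ℕ, ∀ a : ℤ, a < -J → ((rep hW z).coeff b).coeff a = 0 := by
    intro b
    refine ⟨((rep hW z).coeff b).order.natAbs, fun a ha => ?_⟩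
    exact HahnSeries.coeff_eq_zero_of_lt_order (by omega)
  choose J hJ using hf
  refine ⟨(Finset.range W.natDegree).sup J, (X_pow_smul_mem_range_iff hW _ z).2 fun b a ha => ?_⟩
  by_cases hb : b < W.natDegree
  · refine hJ b a (ha.trans_le ?_)
    have := Finset.le_sup (f := J) (Finset.mem_range.2 hb)
    omega
  · rw [coeff_eq_zero_of_degree_lt, HahnSeries.coeff_zero]
    refine (degree_rep_lt hW z).trans_le ?_
    exact_mod_cast not_lt.1 hb

/-- `K((x))[y]/(W)` as an algebra over `K[[x]][y]/(W)`. -/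
instance curveAlgAlgebra : Algebra (AdjoinRoot W) (CurveAlg W) :=
  (toCurveAlg W).toRingHom.toAlgebra

instance isScalarTower_curveAlg : IsScalarTower K⟦X⟧ (AdjoinRoot W) (CurveAlg W) :=
  IsScalarTower.of_algebraMap_eq fun a => ((toCurveAlg W).commutes a).symm

theorem finite_curveAlg (hW : W.Monic) : Module.Finite (LaurentSeries K) (CurveAlg W) :=
  (hW.map (algebraMap K⟦X⟧ (LaurentSeries K))).finite_adjoinRoot

theorem isUnit_algebraMap_X_pow (J : ℕ) :
    IsUnit (algebraMap K⟦X⟧ (CurveAlg W) (PowerSeries.X ^ J)) := by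
  rw [IsScalarTower.algebraMap_apply K⟦X⟧ (LaurentSeries K) (CurveAlg W)]
  refine IsUnit.map _ (IsUnit.mk0 _ ?_)
  rw [Ne, FaithfulSMul.algebraMap_eq_zero_iff]
  exact pow_ne_zero _ PowerSeries.X_ne_zero

theorem isFractionRing_curveAlg (hW : W.Monic) :
    IsFractionRing (AdjoinRoot W) (CurveAlg W) := by
  have hinj : Function.Injective (algebraMap (AdjoinRoot W) (CurveAlg W)) :=
    toCurveAlg_injective hW
  have := finite_curveAlg hW
  have hart : IsArtinianRing (CurveAlg W) := IsArtinianRing.of_finite (LaurentSeries K) _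
  have hsm : ∀ z : CurveAlg W, ∃ J : ℕ, ∃ y : AdjoinRoot W,
      z * algebraMap K⟦X⟧ (CurveAlg W) (PowerSeries.X ^ J) =
        algebraMap (AdjoinRoot W) (CurveAlg W) y := by
    intro z
    obtain ⟨J, y, hy⟩ := exists_X_pow_smul_mem_range hW z
    exact ⟨J, y, by rw [mul_comm, ← Algebra.smul_def]; exact hy.symm⟩
  refine ⟨?_, ?_, ?_⟩
  · rintro ⟨b, hb⟩
    apply IsArtinianRing.isUnit_of_mem_nonZeroDivisors
    rw [mem_nonZeroDivisors_iff_right]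
    intro z hz
    obtain ⟨J, y, hy⟩ := hsm z
    have h1 : y * b = 0 := by
      apply hinj
      rw [map_mul, ← hy, map_zero]
      calc _ = z * algebraMap (AdjoinRoot W) (CurveAlg W) b * algebraMap K⟦X⟧ (CurveAlg W)
            (PowerSeries.X ^ J) := by ring
        _ = 0 := by rw [hz, zero_mul]
    have h2 : y = 0 := (mem_nonZeroDivisors_iff_right.1 hb) y h1
    rw [h2, map_zero] at hy
    exact (isUnit_algebraMap_X_pow J).mul_left_eq_zero.1 hy
  · intro z
    obtain ⟨J, y, hy⟩ := hsm z
    refine ⟨⟨y, algebraMap K⟦X⟧ (AdjoinRoot W) (PowerSeries.X ^ J), ?_⟩, ?_⟩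
    · rw [mem_nonZeroDivisors_iff_right]
      intro w hw
      apply hinj
      have := congrArg (algebraMap (AdjoinRoot W) (CurveAlg W)) hw
      rw [map_mul, map_zero, ← IsScalarTower.algebraMap_apply] at this
      rw [map_zero]
      exact (isUnit_algebraMap_X_pow J).mul_left_eq_zero.1 this
    · rw [← hy, ← IsScalarTower.algebraMap_apply]
  · intro a b hab
    exact ⟨1, by rw [hinj hab]⟩

/-- The coefficients of `x^{-j-1} y^i`, `j < k i`, in the reduced representative. -/
def polarPart (hW : W.Monic) (k : Fin W.natDegree → ℕ) :
    CurveAlg W →+ ((Σ i, Fin (k i)) → K) where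
  toFun z := fun ij => ((rep hW z).coeff ij.1).coeff (-(ij.2 + 1 : ℤ))
  map_zero' := by ext; simp
  map_add' z w := by ext; simp

theorem polarPart_C_mul (hW : W.Monic) (k : Fin W.natDegree → ℕ) (c : K) (z : CurveAlg W) :
    polarPart hW k (algebraMap K⟦X⟧ (CurveAlg W) (PowerSeries.C c) * z) =
      c • polarPart hW k z := by
  ext ij
  rw [IsScalarTower.algebraMap_apply K⟦X⟧ (LaurentSeries K) (CurveAlg W), ← Algebra.smul_def]
  change ((rep hW _).coeff _).coeff _ = c * ((rep hW z).coeff _).coeff _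
  rw [map_smul, coeff_smul, smul_eq_mul]
  have : algebraMap K⟦X⟧ (LaurentSeries K) (PowerSeries.C c) = HahnSeries.C c :=
    HahnSeries.ofPowerSeries_C c
  rw [this, HahnSeries.C_mul_eq_smul]
  rfl

variable {α β : ℕ} [NeZero α] (hW : W.Monic) (hw : WGe α β (β * W.natDegree) (toLaurent W))

theorem polarPart_eq_zero_iff {z : CurveAlg W} (hz : z ∈ weightOrder hW hw) :
    polarPart hW (fun i => β * i / α) z = 0 ↔ z ∈ (toCurveAlg W).range := by
  rw [mem_range_toCurveAlg_iff hW]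
  constructor
  · intro h b a ha
    by_contra hne
    have hb : b < W.natDegree := by
      by_contra hb
      apply hne
      rw [coeff_eq_zero_of_degree_lt, HahnSeries.coeff_zero]
      refine (degree_rep_lt hW z).trans_le ?_
      exact_mod_cast not_lt.1 hb
    have hk := (wge_iff.1 ((mem_weightOrder hW hw).1 hz)) b a hne
    obtain ⟨j, rfl⟩ : ∃ j : ℕ, a = -(j + 1 : ℤ) := ⟨(-a - 1).toNat, by omega⟩
    have hj : j < β * b / α := by
      rw [Nat.lt_iff_add_one_le, Nat.le_div_iff_mul_le (NeZero.pos α)]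
      zify
      linarith
    exact hne (congrFun h ⟨⟨b, hb⟩, ⟨j, hj⟩⟩)
  · intro h
    ext ij
    exact h _ _ (by omega)

theorem exists_polarPart_eq (v : (Σ i : Fin W.natDegree, Fin (β * i / α)) → K) :
    ∃ z ∈ weightOrder hW hw, polarPart hW (fun i => β * i / α) z = v := by
  let q : Fin W.natDegree → LaurentSeries K := fun i =>
    ∑ j : Fin (β * i / α), HahnSeries.single (-((j : ℕ) + 1 : ℤ)) (v ⟨i, j⟩)
  let P : (LaurentSeries K)[X] := ∑ i, C (q i) * X ^ (i : ℕ)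
  have hPc : ∀ i : Fin W.natDegree, P.coeff i = q i := by
    intro i
    simp only [P, finsetSum_coeff, coeff_C_mul_X_pow, Fin.val_inj]
    simp
  have hPd : P.degree < W.natDegree := by
    refine (degree_sum_le _ _).trans_lt ?_
    rw [Finset.sup_lt_iff (by exact WithBot.bot_lt_coe _)]
    intro i _
    exact (degree_C_mul_X_pow_le _ _).trans_lt (by exact_mod_cast i.2)
  have hqc : ∀ i (a : ℤ), (q i).coeff a =
      ∑ j : Fin (β * i / α), if a = -((j : ℕ) + 1 : ℤ) then v ⟨i, j⟩ else 0 := by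
    intro i a
    simp only [q, HahnSeries.coeff_sum, HahnSeries.coeff_single]
    refine Finset.sum_congr rfl fun j _ => ?_
    congr
  refine ⟨AdjoinRoot.mk _ P, ?_, ?_⟩
  · rw [mem_weightOrder, rep_mk_of_degree_lt hW hPd, wge_iff]
    intro b a hab
    have hb : b < W.natDegree := by
      by_contra hb
      apply hab
      rw [coeff_eq_zero_of_degree_lt, HahnSeries.coeff_zero]
      refine hPd.trans_le ?_
      exact_mod_cast not_lt.1 hb
    have h := hPc ⟨b, hb⟩
    simp only at h
    rw [h, hqc] at hab
    obtain ⟨j, -, hj⟩ := Finset.exists_ne_zero_of_sum_ne_zero hab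
    have ha : a = -((j : ℕ) + 1 : ℤ) := by
      by_contra h'
      rw [if_neg h'] at hj
      exact hj rfl
    have hj2 := j.2
    rw [Nat.lt_iff_add_one_le, Nat.le_div_iff_mul_le (NeZero.pos α)] at hj2
    zify at hj2
    rw [ha]
    linarith
  · ext ⟨i, j⟩
    change ((rep hW _).coeff _).coeff _ = _
    rw [rep_mk_of_degree_lt hW hPd]
    rw [hPc, hqc, Finset.sum_eq_single j]
    · simp
    · intro j' _ hne
      rw [if_neg]
      intro h
      apply hne
      change -(((j : ℕ) : ℤ) + 1) = -((j' : ℕ) + 1 : ℤ) at h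
      ext
      omega
    · simp

end PolarPart

section DeltaInvariant

open Polynomial
open scoped PowerSeries

variable {K : Type u} [Field K] {W : K⟦X⟧[X]} (hW : W.Monic)

include hW in
theorem exists_X_pow_smul_integral_mem_range [IsReduced (CurveAlg W)] :
    ∃ J : ℕ, ∀ z : CurveAlg W, IsIntegral K⟦X⟧ z →
      (PowerSeries.X ^ J : K⟦X⟧) • z ∈ (toCurveAlg W).range := by
  have := finite_curveAlg hW
  have hfin : Module.Finite K⟦X⟧ (integralClosure K⟦X⟧ (CurveAlg W)) :=
    finite_integralClosure (LaurentSeries K)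
  obtain ⟨S, hS⟩ := Module.finite_def.1 hfin
  choose J hJ using exists_X_pow_smul_mem_range (W := W) hW
  let M : Submodule K⟦X⟧ (integralClosure K⟦X⟧ (CurveAlg W)) :=
    (Subalgebra.toSubmodule (toCurveAlg W).range).comap
      ((PowerSeries.X ^ (S.sup fun z => J z) : K⟦X⟧) • (integralClosure K⟦X⟧ (CurveAlg W)).val.toLinearMap)
  have hM : M = ⊤ := by
    rw [eq_top_iff, ← hS, Submodule.span_le]
    intro z hz
    have hle : J z ≤ S.sup fun z => J z := 
      Finset.le_sup (f := fun z : integralClosure K⟦X⟧ (CurveAlg W) => J z) hz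
    change (PowerSeries.X ^ (S.sup fun z => J z) : K⟦X⟧) • (z : CurveAlg W) ∈ (toCurveAlg W).range
    rw [← Nat.sub_add_cancel hle, pow_add, mul_smul]
    exact (toCurveAlg W).range.smul_mem (hJ z) _
  refine ⟨S.sup fun z => J z, fun z hz => ?_⟩
  have : (⟨z, hz⟩ : integralClosure K⟦X⟧ (CurveAlg W)) ∈ M := hM ▸ Submodule.mem_top
  exact this

variable {α β : ℕ} [NeZero α] (hw : WGe α β (β * W.natDegree) (toLaurent W))

theorem finrank_integralClosure_quotient [IsReduced (CurveAlg W)]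
    {O : Type u} [CommRing O] [Algebra K O] (θ : O ≃+* AdjoinRoot W)
    (hθ : ∀ c, θ (algebraMap K O c) = algebraMap K⟦X⟧ (AdjoinRoot W) (PowerSeries.C c))
    (L : Type u) [CommRing L] [Algebra K L] [Algebra O L] [IsScalarTower K O L]
    [IsFractionRing O L] {N P : Submodule K L}
    (hN : N = Submodule.span K (integralClosure O L : Set L))
    (hP : P = Submodule.span K (Set.range (algebraMap O L))) :
    (∑ i ∈ Finset.range W.natDegree, β * i / α ≤ Module.finrank K (N ⧸ P.comap N.subtype)) ∧
      ((∀ z : CurveAlg W, IsIntegral K⟦X⟧ z → z ∈ weightOrder hW hw) →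
        Module.finrank K (N ⧸ P.comap N.subtype) = ∑ i ∈ Finset.range W.natDegree, β * i / α) := by
  have := isFractionRing_curveAlg hW
  let e : L ≃+* CurveAlg W := IsFractionRing.ringEquivOfRingEquiv θ
  have he : ∀ o, e (algebraMap O L o) = algebraMap (AdjoinRoot W) (CurveAlg W) (θ o) :=
    fun o => IsFractionRing.ringEquivOfRingEquiv_algebraMap θ o
  have hsmul : ∀ (c : K) (z : L),
      e (c • z) = algebraMap K⟦X⟧ (CurveAlg W) (PowerSeries.C c) * e z := by
    intro c z
    rw [Algebra.smul_def, map_mul, IsScalarTower.algebraMap_apply K O L, he, hθ,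
      ← IsScalarTower.algebraMap_apply]
  have hmemP : ∀ z, z ∈ P ↔ e z ∈ (toCurveAlg W).range := by
    intro z
    have h1 : P = ((IsScalarTower.toAlgHom K O L).range.toSubmodule) := by
      rw [hP]
      exact Submodule.span_eq (IsScalarTower.toAlgHom K O L).range.toSubmodule
    rw [h1]
    constructor
    · rintro ⟨o, rfl⟩
      exact ⟨θ o, (he o).symm⟩
    · rintro ⟨y, hy⟩
      refine ⟨θ.symm y, e.injective ?_⟩
      change e (algebraMap O L (θ.symm y)) = _
      rw [he, θ.apply_symm_apply]
      exact hy
  have hInt : ∀ z : CurveAlg W, IsIntegral (AdjoinRoot W) z ↔ IsIntegral K⟦X⟧ z := by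
    have hfin : Module.Finite K⟦X⟧ (AdjoinRoot W) := hW.finite_adjoinRoot
    exact fun z => ⟨fun h => isIntegral_trans z h, fun h => h.tower_top⟩
  have hmemN : ∀ z, z ∈ N ↔ IsIntegral K⟦X⟧ (e z) := by
    intro z
    have h1 : N = (Subalgebra.toSubmodule (integralClosure O L)).restrictScalars K := by
      rw [hN]
      exact Submodule.span_eq ((Subalgebra.toSubmodule (integralClosure O L)).restrictScalars K)
    rw [h1, ← hInt]
    change IsIntegral O z ↔ _
    constructor
    · exact fun h => h.map_of_comp_eq θ.toRingHom e.toRingHom (RingHom.ext fun o => (he o).symm)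
    · intro h
      have := h.map_of_comp_eq θ.symm.toRingHom e.symm.toRingHom (RingHom.ext fun y => by
        apply e.injective
        change e (algebraMap O L (θ.symm y)) = e (e.symm _)
        rw [he, θ.apply_symm_apply, e.apply_symm_apply])
      change IsIntegral O (e.symm (e z)) at this
      rwa [e.symm_apply_apply] at this
  let Φ : (k : Fin W.natDegree → ℕ) → L →ₗ[K] ((Σ i, Fin (k i)) → K) := fun k =>
    { toFun := fun z => polarPart hW k (e z)
      map_add' := fun z w => by rw [map_add, map_add]
      map_smul' := fun c z => by rw [hsmul, polarPart_C_mul]; rfl }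
  obtain ⟨J, hJ⟩ := exists_X_pow_smul_integral_mem_range hW
  have hfinq : Module.Finite K (N ⧸ P.comap N.subtype) := by
    refine finite_quotient_of_ker (Φ fun _ => J) fun z hz => ?_
    rw [hmemP]
    have h1 := (X_pow_smul_mem_range_iff hW J (e z)).1 (hJ _ ((hmemN z).1 hz))
    rw [mem_range_toCurveAlg_iff hW]
    constructor
    · intro h b a ha
      by_cases hb : b < W.natDegree
      · by_cases ha' : a < -J
        · exact h1 b a ha'
        · have h2 := congrFun h ⟨⟨b, hb⟩, ⟨(-a - 1).toNat, by omega⟩⟩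
          change ((rep hW (e z)).coeff b).coeff (-(((-a - 1).toNat : ℤ) + 1)) = 0 at h2
          rwa [show -(((-a - 1).toNat : ℤ) + 1) = a by omega] at h2
      · rw [coeff_eq_zero_of_degree_lt, HahnSeries.coeff_zero]
        refine (degree_rep_lt hW (e z)).trans_le ?_
        exact_mod_cast not_lt.1 hb
    · intro h
      ext ij
      exact h _ _ (by omega)
  let B : Submodule K L :=
    { carrier := {z | e z ∈ weightOrder hW hw}
      add_mem' := fun {z w} hz hz' => by
        change e (z + w) ∈ weightOrder hW hw
        rw [map_add]; exact add_mem hz hz'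
      zero_mem' := by change e 0 ∈ weightOrder hW hw; rw [map_zero]; exact zero_mem _
      smul_mem' := fun c z hz => by
        change e (c • z) ∈ weightOrder hW hw
        rw [hsmul]; exact mul_mem (Subalgebra.algebraMap_mem _ _) hz }
  have hfr : Module.finrank K ((Σ i : Fin W.natDegree, Fin (β * i / α)) → K) =
      ∑ i ∈ Finset.range W.natDegree, β * i / α := by
    rw [Module.finrank_fintype_fun_eq_card, Fintype.card_sigma, Finset.sum_range]
    simp
  have key := finrank_le_finrank_quotient (N := N) (P := P) (B := B) (Φ fun i => β * i / α)
    (fun z hz => (hmemN z).2 (isIntegral_of_mem_weightOrder hW hw hz))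
    (fun z hz => by rw [hmemP]; exact polarPart_eq_zero_iff hW hw hz)
    (fun v => by
      obtain ⟨z, hz, hzv⟩ := exists_polarPart_eq hW hw v
      refine ⟨e.symm z, ?_, ?_⟩
      · change e (e.symm z) ∈ weightOrder hW hw
        rwa [e.apply_symm_apply]
      · change polarPart hW _ (e (e.symm z)) = v
        rwa [e.apply_symm_apply])
  rw [hfr] at key
  exact ⟨key.1, fun h => key.2 fun z hz => h _ ((hmemN z).1 hz)⟩

end DeltaInvariant

section Factors

open Polynomial
open scoped PowerSeries

theorem exists_monic_prime_factors {R : Type*} [CommRing R] [IsDomain R]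
    [UniqueFactorizationMonoid R] :
    ∀ (n : ℕ) (W : R[X]), W.Monic → W.natDegree = n →
      ∃ s : Multiset R[X], (∀ p ∈ s, p.Monic ∧ Prime p) ∧ s.prod = W := by
  intro n
  induction n using Nat.strong_induction_on with
  | _ n ih =>
    intro W hW hn
    by_cases h1 : W = 1
    · exact ⟨0, by simp, by simp [h1]⟩
    by_cases hirr : Irreducible W
    · exact ⟨{W}, by simpa using ⟨hW, hirr.prime⟩, by simp⟩
    rw [hW.irreducible_iff_natDegree, not_and] at hirr
    have h2 := hirr h1
    push Not at h2
    obtain ⟨p, q, hp, hq, hpq, hp0, hq0⟩ := h2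
    have hdeg : p.natDegree + q.natDegree = n := by rw [← hp.natDegree_mul hq, hpq, hn]
    obtain ⟨s, hs, hsp⟩ := ih p.natDegree (by omega) p hp rfl
    obtain ⟨t, ht, htp⟩ := ih q.natDegree (by omega) q hq rfl
    refine ⟨s + t, fun x hx => ?_, by rw [Multiset.prod_add, hsp, htp, hpq]⟩
    rcases Multiset.mem_add.1 hx with h | h
    · exact hs x h
    · exact ht x h

variable {K : Type u} [Field K] {α β : ℕ} [NeZero α]

theorem wge_toLaurent_of_mul {p q : K⟦X⟧[X]} (hp : p.Monic) (hq : q.Monic)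
    (h : WGe α β (β * (p * q).natDegree) (toLaurent (p * q))) :
    WGe α β (β * p.natDegree) (toLaurent p) := by
  obtain ⟨k, hk, hk'⟩ := exists_exact_weight (α := α) (β := β)
    (hp.map (algebraMap K⟦X⟧ (LaurentSeries K))).ne_zero
  obtain ⟨l, hl, hl'⟩ := exists_exact_weight (α := α) (β := β)
    (hq.map (algebraMap K⟦X⟧ (LaurentSeries K))).ne_zero
  have h1 : sym α β (k + l) (toLaurent (p * q)) ≠ 0 := by
    have : toLaurent (p * q) = toLaurent p * toLaurent q := Polynomial.map_mul _
    rw [this, sym_mul hk hl]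
    exact mul_ne_zero hk' hl'
  have h2 := le_of_exact_weight h1 h
  have h3 := le_of_exact_weight (sym_toLaurent_ne_zero (α := α) (β := β) hp) hk
  have h4 := le_of_exact_weight (sym_toLaurent_ne_zero (α := α) (β := β) hq) hl
  rw [hp.natDegree_mul hq] at h2
  refine hk.mono ?_
  push_cast at h2
  rw [mul_add] at h2
  linarith

theorem sym_toLaurent_mul {p q : K⟦X⟧[X]} (hp : p.Monic) (hq : q.Monic)
    (h : WGe α β (β * (p * q).natDegree) (toLaurent (p * q))) :
    sym α β (β * (p * q).natDegree) (toLaurent (p * q)) =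
      sym α β (β * p.natDegree) (toLaurent p) * sym α β (β * q.natDegree) (toLaurent q) := by
  have h1 := wge_toLaurent_of_mul hp hq h
  have h2 := wge_toLaurent_of_mul hq hp (by rwa [mul_comm q p])
  rw [← sym_mul h1 h2, hp.natDegree_mul hq]
  congr 1
  · push_cast
    ring
  · exact Polynomial.map_mul _

theorem isDistinguishedAt_of_wge (hβ : 0 < β) {p : K⟦X⟧[X]} (hp : p.Monic)
    (h : WGe α β (β * p.natDegree) (toLaurent p)) :
    p.IsDistinguishedAt (IsLocalRing.maximalIdeal K⟦X⟧) := by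
  refine ⟨⟨fun {b} hb => ?_⟩, hp⟩
  rw [IsLocalRing.mem_maximalIdeal, mem_nonunits_iff, PowerSeries.isUnit_iff_constantCoeff,
    isUnit_iff_ne_zero, not_not]
  by_contra hc
  have := (wge_toLaurent_iff (N := β * p.natDegree)).1 (by exact_mod_cast h) 0 b
    (by rwa [PowerSeries.coeff_zero_eq_constantCoeff])
  rw [mul_zero, zero_add] at this
  exact absurd (Nat.le_of_mul_le_mul_left this hβ) (by omega)

theorem dvd_natDegree_of_coeff_sym_ne_zero (hcop : Nat.Coprime α β) {p : K⟦X⟧[X]}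
    (h : (sym α β (β * p.natDegree) (toLaurent p)).coeff 0 ≠ 0) : α ∣ p.natDegree := by
  obtain ⟨a, ha, -⟩ := exists_of_coeff_sym_ne_zero h
  have : (α : ℤ) ∣ ((β * p.natDegree : ℕ) : ℤ) := ⟨a, by push_cast; rw [ha]; simp⟩
  exact hcop.dvd_of_dvd_mul_left (by exact_mod_cast this)

theorem prime_coe_of_isDistinguishedAt {A : Type*} [CommRing A] [IsDomain A] [IsLocalRing A]
    [IsAdicComplete (IsLocalRing.maximalIdeal A) A] {p : A[X]}
    (hp : p.IsDistinguishedAt (IsLocalRing.maximalIdeal A)) (hprime : Prime p) :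
    Prime (p : A⟦X⟧) := by
  have h0 : (p : A⟦X⟧) ≠ 0 := fun h => hprime.ne_zero (Polynomial.coe_eq_zero_iff.1 h)
  rw [← Ideal.span_singleton_prime h0, ← Ideal.Quotient.isDomain_iff_prime]
  have := (Ideal.span_singleton_prime hprime.ne_zero).2 hprime
  exact hp.algEquivQuotient.symm.toMulEquiv.isDomain

theorem isReduced_adjoinRoot_of_squarefree {W : K⟦X⟧[X]} (h : Squarefree W) :
    IsReduced (AdjoinRoot W) := by
  have h0 : W ≠ 0 := h.ne_zero
  have h1 : (Ideal.span {W}).IsRadical := by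
    rw [← isRadical_iff_span_singleton]
    exact h.isRadical
  exact (Ideal.isRadical_iff_quotient_reduced _).1 h1

theorem isReduced_curveAlg {W : K⟦X⟧[X]} (hW : W.Monic) (h : Squarefree W) :
    IsReduced (CurveAlg W) := by
  have := isReduced_adjoinRoot_of_squarefree h
  refine ⟨fun z hz => ?_⟩
  obtain ⟨J, y, hy⟩ := exists_X_pow_smul_mem_range hW z
  have h1 : IsNilpotent ((PowerSeries.X ^ J : K⟦X⟧) • z) := by
    obtain ⟨k, hk⟩ := hz
    exact ⟨k, by rw [Algebra.smul_def, mul_pow, hk, mul_zero]⟩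
  have h2 : IsNilpotent y := by
    rw [← IsNilpotent.map_iff (toCurveAlg_injective hW)]
    change IsNilpotent (toCurveAlg W y)
    rw [← hy] at h1
    exact h1
  rw [Algebra.smul_def] at hy
  have h3 : y = 0 := h2.eq_zero
  rw [h3] at hy
  have hu := isUnit_algebraMap_X_pow (W := W) J
  have h4 := hy.symm
  change _ = toCurveAlg W 0 at h4
  rw [map_zero] at h4
  exact hu.mul_right_eq_zero.1 h4

end Factors

section Branches

open Polynomial
open scoped PowerSeries

variable {K : Type u} [Field K] {α β : ℕ} [NeZero α]

theorem eq_mul_erase_prod {W : K⟦X⟧[X]} {s : Multiset K⟦X⟧[X]} (hs : ∀ p ∈ s, p.Monic)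
    (hprod : s.prod = W) {p : K⟦X⟧[X]} (hp : p ∈ s) : ∃ q : K⟦X⟧[X], q.Monic ∧ W = p * q := by
  refine ⟨(s.erase p).prod, ?_, ?_⟩
  · rw [← Multiset.map_id (s.erase p)]
    refine monic_multiset_prod_of_monic _ id fun q hq => ?_
    exact hs q (Multiset.mem_of_mem_erase hq)
  · rw [Multiset.prod_erase hp, hprod]

theorem wge_of_mem {W : K⟦X⟧[X]} {s : Multiset K⟦X⟧[X]} (hs : ∀ p ∈ s, p.Monic)
    (hprod : s.prod = W) (hw : WGe α β (β * W.natDegree) (toLaurent W)) {p : K⟦X⟧[X]}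
    (hp : p ∈ s) : WGe α β (β * p.natDegree) (toLaurent p) ∧
      sym α β (β * p.natDegree) (toLaurent p) ∣ sym α β (β * W.natDegree) (toLaurent W) := by
  obtain ⟨q, hq, rfl⟩ := eq_mul_erase_prod hs hprod hp
  exact ⟨wge_toLaurent_of_mul (hs p hp) hq hw, ⟨_, sym_toLaurent_mul (hs p hp) hq hw⟩⟩

variable {f : PS K} {W : K⟦X⟧[X]} {h : K⟦X⟧⟦X⟧}

theorem prime_coe_of_mem (hβ : 0 < β) {s : Multiset K⟦X⟧[X]}
    (hs : ∀ p ∈ s, p.Monic ∧ Prime p) (hprod : s.prod = W)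
    (hw : WGe α β (β * W.natDegree) (toLaurent W)) {p : K⟦X⟧[X]} (hp : p ∈ s) :
    Prime (p : K⟦X⟧⟦X⟧) :=
  prime_coe_of_isDistinguishedAt (isDistinguishedAt_of_wge hβ (hs p hp).1
    (wge_of_mem (fun q hq => (hs q hq).1) hprod hw hp).1) (hs p hp).2

theorem numFactors_eq_card (H : (toIter f).IsWeierstrassFactorization W h) (hf : Squarefree f)
    (hβ : 0 < β) {s : Multiset K⟦X⟧[X]} (hs : ∀ p ∈ s, p.Monic ∧ Prime p) (hprod : s.prod = W)
    (hw : WGe α β (β * W.natDegree) (toLaurent W)) : numFactors K f = s.card := by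
  have : IsDomain (PS K) := (toIter (K := K)).toMulEquiv.isDomain
  rw [numFactors, ncard_irreducible_dvd (s.map fun p : K⟦X⟧[X] => toIter.symm (p : K⟦X⟧⟦X⟧)) _ _ hf,
    Multiset.card_map]
  · intro q hq
    obtain ⟨p, hp, rfl⟩ := Multiset.mem_map.1 hq
    exact (MulEquiv.prime_iff (toIter (K := K)).symm).2 (prime_coe_of_mem hβ hs hprod hw hp)
  · have h1 : (s.map fun p : K⟦X⟧[X] => toIter.symm (p : K⟦X⟧⟦X⟧)).prod =
        toIter.symm (W : K⟦X⟧⟦X⟧) := by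
      rw [← hprod]
      have := map_multiset_prod
        ((toIter (K := K)).symm.toRingHom.comp (Polynomial.coeToPowerSeries.ringHom)) s
      exact this.symm
    rw [h1]
    have h2 : f = toIter.symm (W : K⟦X⟧⟦X⟧) * toIter.symm h := by
      rw [← map_mul, ← H.eq_mul, AlgEquiv.symm_apply_apply]
    obtain ⟨v, hv⟩ := H.isUnit.map (toIter (K := K)).symm
    refine Associated.symm ⟨v, ?_⟩
    rw [hv]
    exact h2.symm

theorem squarefree_of_factorization (H : (toIter f).IsWeierstrassFactorization W h)
    (hf : Squarefree f) (hβ : 0 < β) {s : Multiset K⟦X⟧[X]} (hs : ∀ p ∈ s, p.Monic ∧ Prime p)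
    (hprod : s.prod = W) (hw : WGe α β (β * W.natDegree) (toLaurent W)) : Squarefree W := by
  have hW0 : W ≠ 0 := H.isDistinguishedAt.monic.ne_zero
  rw [squarefree_iff_irreducible_sq_not_dvd_of_ne_zero hW0]
  intro p hp hpp
  have h1 : p ∣ s.prod := by rw [hprod]; exact (Dvd.intro _ rfl).trans hpp
  obtain ⟨q, hq, hpq⟩ := hp.prime.exists_mem_multiset_dvd h1
  have h2 : Associated p q := hp.associated_of_dvd (hs q hq).2.irreducible hpq
  have h3 : q * q ∣ W := (h2.mul_mul h2).symm.dvd.trans hpp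
  obtain ⟨t, ht⟩ := h3
  have h4 : (q : K⟦X⟧⟦X⟧) * q ∣ toIter f := by
    refine ⟨(t : K⟦X⟧⟦X⟧) * h, ?_⟩
    rw [H.eq_mul, ht, Polynomial.coe_mul, Polynomial.coe_mul, mul_assoc]
  have h5 : toIter.symm (q : K⟦X⟧⟦X⟧) * toIter.symm (q : K⟦X⟧⟦X⟧) ∣ f := by
    have := map_dvd (toIter (K := K)).symm h4
    rwa [map_mul, AlgEquiv.symm_apply_apply] at this
  have h6 := hf _ h5
  exact ((MulEquiv.prime_iff (toIter (K := K)).symm).2 (prime_coe_of_mem hβ hs hprod hw hq)).not_isUnit h6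

theorem natDegree_ge_of_mem (hcop : Nat.Coprime α β) {s : Multiset K⟦X⟧[X]}
    (hs : ∀ p ∈ s, p.Monic ∧ Prime p) (hprod : s.prod = W)
    (hw : WGe α β (β * W.natDegree) (toLaurent W))
    (h0 : (sym α β (β * W.natDegree) (toLaurent W)).coeff 0 ≠ 0) {p : K⟦X⟧[X]} (hp : p ∈ s) :
    ∃ e, 0 < e ∧ p.natDegree = α * e := by
  obtain ⟨g, hg⟩ := (wge_of_mem (fun q hq => (hs q hq).1) hprod hw hp).2
  rw [hg, mul_coeff_zero] at h0
  obtain ⟨e, he⟩ := dvd_natDegree_of_coeff_sym_ne_zero hcop (left_ne_zero_of_mul h0)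
  refine ⟨e, Nat.pos_of_ne_zero ?_, he⟩
  rintro rfl
  rw [mul_zero, (hs p hp).1.natDegree_eq_zero] at he
  exact (hs p hp).2.not_isUnit (by rw [he]; exact isUnit_one)

omit [NeZero α] in
theorem card_mul_le {s : Multiset K⟦X⟧[X]} (hs : ∀ p ∈ s, p.Monic)
    (he : ∀ p ∈ s, ∃ e, 0 < e ∧ p.natDegree = α * e) : s.card * α ≤ s.prod.natDegree := by
  rw [natDegree_multiset_prod_of_monic s hs]
  have : ∀ x ∈ s.map natDegree, α ≤ x := by
    intro x hx
    obtain ⟨p, hp, rfl⟩ := Multiset.mem_map.1 hx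
    obtain ⟨e, he0, he1⟩ := he p hp
    rw [he1]
    exact Nat.le_mul_of_pos_right _ he0
  simpa using Multiset.card_nsmul_le_sum this

omit [NeZero α] in
theorem card_mul_eq {s : Multiset K⟦X⟧[X]} (hs : ∀ p ∈ s, p.Monic)
    (he : ∀ p ∈ s, p.natDegree = α) : s.prod.natDegree = s.card * α := by
  rw [natDegree_multiset_prod_of_monic s hs, Multiset.map_congr rfl he]
  simp

end Branches

section Delta

open Polynomial
open scoped PowerSeries

theorem finrank_quotient_comap_congr {F M M' : Type*} [Field F] [AddCommGroup M] [Module F M]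
    [AddCommGroup M'] [Module F M'] (e : M ≃ₗ[F] M') {N P : Submodule F M} {N' P' : Submodule F M'}
    (hN : ∀ z, e z ∈ N' ↔ z ∈ N) (hP : ∀ z, e z ∈ P' ↔ z ∈ P) :
    Module.finrank F (N ⧸ P.comap N.subtype) = Module.finrank F (N' ⧸ P'.comap N'.subtype) := by
  have h1 : N = N'.comap e.toLinearMap := Submodule.ext fun z => (hN z).symm
  have h2 : P = P'.comap e.toLinearMap := Submodule.ext fun z => (hP z).symm
  have h3 : N.map e.toLinearMap = N' := by
    rw [h1, Submodule.map_comap_eq_of_surjective e.surjective]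
  refine (Submodule.Quotient.equiv _ _ (e.ofSubmodules N N' h3) ?_).finrank_eq
  ext z
  rw [Submodule.mem_map_equiv, Submodule.mem_comap, Submodule.mem_comap]
  exact (hP _).symm.trans (by
    rw [show e (N.subtype ((e.ofSubmodules N N' h3).symm z)) = N'.subtype z from
      congrArg Subtype.val ((e.ofSubmodules N N' h3).apply_symm_apply z)])

/-- A Weierstrass factorization identifies `A⟦X⟧ / (g)` with `A[X] / (W)`. -/
def weierstrassQuotEquiv {A : Type*} [CommRing A] [IsLocalRing A]
    [IsAdicComplete (IsLocalRing.maximalIdeal A) A] {g h : A⟦X⟧} {W : A[X]}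
    (H : g.IsWeierstrassFactorization W h) : (A⟦X⟧ ⧸ Ideal.span {g}) ≃+* AdjoinRoot W :=
  H.algEquivQuotient.symm.toRingEquiv

theorem weierstrassQuotEquiv_C {A : Type*} [CommRing A] [IsLocalRing A]
    [IsAdicComplete (IsLocalRing.maximalIdeal A) A] {g h : A⟦X⟧} {W : A[X]}
    (H : g.IsWeierstrassFactorization W h) (a : A) :
    weierstrassQuotEquiv H (Ideal.Quotient.mk _ (PowerSeries.C a)) =
      algebraMap A (AdjoinRoot W) a :=
  H.algEquivQuotient.symm.commutes a

variable {K : Type u} [Field K]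

theorem toIter_algebraMap (c : K) :
    toIter (algebraMap K (PS K) c) = PowerSeries.C (PowerSeries.C c) := by
  ext b a
  rw [coeff_toIter, coef, MvPowerSeries.algebraMap_apply, MvPowerSeries.coeff_C,
    PowerSeries.coeff_C]
  by_cases hb : b = 0
  · subst hb
    rw [if_pos rfl, PowerSeries.coeff_C]
    simp
  · rw [if_neg hb, if_neg]
    · simp
    · intro h
      have := DFunLike.congr_fun h 1
      simp at this
      exact hb this

/-- The local ring of the curve as a finite algebra over `K⟦X⟧`. -/
def curveRingEquiv {f : PS K} {W : K⟦X⟧[X]} {h : K⟦X⟧⟦X⟧}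
    (H : (toIter f).IsWeierstrassFactorization W h) : CurveRing K f ≃+* AdjoinRoot W :=
  (Ideal.quotientEquiv (Ideal.span {f}) (Ideal.span {toIter f}) (toIter (K := K)).toRingEquiv
    (by rw [Ideal.map_span, Set.image_singleton]; rfl)).trans (weierstrassQuotEquiv H)

theorem curveRingEquiv_algebraMap {f : PS K} {W : K⟦X⟧[X]} {h : K⟦X⟧⟦X⟧}
    (H : (toIter f).IsWeierstrassFactorization W h) (c : K) :
    curveRingEquiv H (algebraMap K (CurveRing K f) c) =
      algebraMap K⟦X⟧ (AdjoinRoot W) (PowerSeries.C c) := by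
  rw [← weierstrassQuotEquiv_C H, ← toIter_algebraMap, curveRingEquiv, RingEquiv.trans_apply]
  refine congrArg (weierstrassQuotEquiv H) ?_
  rw [← Ideal.Quotient.mk_algebraMap]
  exact Ideal.quotientEquiv_mk _ _ _ _ _

theorem finrank_eq_of_isFractionRing {O : Type*} [CommRing O] [Algebra K O] (L L' : Type u)
    [CommRing L] [Algebra K L] [Algebra O L] [IsScalarTower K O L] [IsFractionRing O L]
    [CommRing L'] [Algebra K L'] [Algebra O L'] [IsScalarTower K O L'] [IsFractionRing O L']
    {N P : Submodule K L} {N' P' : Submodule K L'}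
    (hN : N = Submodule.span K (integralClosure O L : Set L))
    (hP : P = Submodule.span K (Set.range (algebraMap O L)))
    (hN' : N' = Submodule.span K (integralClosure O L' : Set L'))
    (hP' : P' = Submodule.span K (Set.range (algebraMap O L'))) :
    Module.finrank K (N ⧸ P.comap N.subtype) = Module.finrank K (N' ⧸ P'.comap N'.subtype) := by
  let e : L ≃ₐ[O] L' := IsLocalization.algEquiv (nonZeroDivisors O) L L'
  have key : ∀ (F : Type u) [CommRing F] [Algebra K F] [Algebra O F] [IsScalarTower K O F],
      Submodule.span K (integralClosure O F : Set F) =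
        (Subalgebra.toSubmodule (integralClosure O F)).restrictScalars K :=
    fun F _ _ _ _ =>
      Submodule.span_eq ((Subalgebra.toSubmodule (integralClosure O F)).restrictScalars K)
  have key' : ∀ (F : Type u) [CommRing F] [Algebra K F] [Algebra O F] [IsScalarTower K O F],
      Submodule.span K (Set.range (algebraMap O F)) =
        Subalgebra.toSubmodule (IsScalarTower.toAlgHom K O F).range :=
    fun F _ _ _ _ => Submodule.span_eq (Subalgebra.toSubmodule (IsScalarTower.toAlgHom K O F).range)
  refine finrank_quotient_comap_congr (e.restrictScalars K).toLinearEquiv (fun z => ?_) fun z => ?_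
  · rw [hN, hN', key, key]
    exact isIntegral_algEquiv e
  · rw [hP, hP', key', key']
    constructor
    · rintro ⟨o, ho⟩
      exact ⟨o, e.injective ((e.commutes o).trans ho)⟩
    · rintro ⟨o, rfl⟩
      exact ⟨o, (e.commutes o).symm⟩

theorem deltaSpec_delta (f : PS K) : deltaSpec K f (delta K f) := by
  refine Nat.sInf_mem (s := {d | deltaSpec K f d}) ?_
  refine ⟨Module.finrank K
    ((Submodule.span K (integralClosure (CurveRing K f) (FractionRing (CurveRing K f)) : Set _)) ⧸
      (Submodule.span K (Set.range (algebraMap (CurveRing K f)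
        (FractionRing (CurveRing K f))))).comap (Submodule.subtype _)), ?_⟩
  intro L _ _ _ _ _
  exact finrank_eq_of_isFractionRing (FractionRing (CurveRing K f)) L rfl rfl rfl rfl

variable {α β : ℕ} [NeZero α]

theorem sum_le_delta {f : PS K} {W : K⟦X⟧[X]} {h : K⟦X⟧⟦X⟧}
    (H : (toIter f).IsWeierstrassFactorization W h) (hW : W.Monic)
    (hw : WGe α β (β * W.natDegree) (toLaurent W)) (hred : IsReduced (CurveAlg W)) :
    (∑ i ∈ Finset.range W.natDegree, β * i / α ≤ delta K f) ∧
      ((∀ z : CurveAlg W, IsIntegral K⟦X⟧ z → z ∈ weightOrder hW hw) →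
        delta K f = ∑ i ∈ Finset.range W.natDegree, β * i / α) := by
  have h1 := deltaSpec_delta f (FractionRing (CurveRing K f))
  rw [h1]
  exact finrank_integralClosure_quotient hW hw (curveRingEquiv H) (curveRingEquiv_algebraMap H)
    (FractionRing (CurveRing K f)) rfl rfl

end Delta

section Nondegenerate

open Polynomial
open scoped PowerSeries

variable {K : Type u} [Field K] {α β : ℕ} [NeZero α]

theorem exists_mod_eq_of_coeff_sym_ne_zero (hcop : Nat.Coprime α β) (k : ℤ)
    (P : (LaurentSeries K)[X]) :
    ∃ c < α, ∀ b, (sym α β k P).coeff b ≠ 0 → b % α = c := by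
  by_cases h : ∃ b, (sym α β k P).coeff b ≠ 0
  · obtain ⟨b₀, hb₀⟩ := h
    refine ⟨b₀ % α, Nat.mod_lt _ (NeZero.pos α), fun b hb => ?_⟩
    obtain ⟨a₀, ha₀, -⟩ := exists_of_coeff_sym_ne_zero hb₀
    obtain ⟨a, ha, -⟩ := exists_of_coeff_sym_ne_zero hb
    have h1 : (α : ℤ) ∣ β * ((b₀ : ℤ) - b) := ⟨a - a₀, by linear_combination ha - ha₀⟩
    have h2 : (α : ℤ) ∣ (b₀ : ℤ) - b := (Nat.isCoprime_iff_coprime.2 hcop).dvd_of_dvd_mul_left h1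
    exact (Nat.modEq_iff_dvd.2 h2)
  · push Not at h
    exact ⟨0, NeZero.pos α, fun b hb => absurd (h b) hb⟩

variable {W : K⟦X⟧[X]} (hW : W.Monic) (hw : WGe α β (β * W.natDegree) (toLaurent W))

include hw in
theorem sym_rep_sq_ne_zero (hcop : Nat.Coprime α β) {φ : K[X]}
    (hφ : sym α β (β * W.natDegree) (toLaurent W) = expand K α φ) (hsq : Squarefree φ)
    (h0 : φ.coeff 0 ≠ 0) {z : CurveAlg W} {k : ℤ} (hk : WGe α β k (rep hW z))
    (hk' : sym α β k (rep hW z) ≠ 0) :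
    WGe α β (k + k) (rep hW (z * z)) ∧ sym α β (k + k) (rep hW (z * z)) ≠ 0 := by
  refine ⟨wge_rep_mul hW hw hk hk, fun h => hk' ?_⟩
  have h1 := sym_dvd_sym_modByMonic hW hw (hk.mul hk)
  rw [← rep_mul, h, sub_zero, sym_mul hk hk] at h1
  obtain ⟨c, hc, hc'⟩ := exists_mod_eq_of_coeff_sym_ne_zero hcop k (rep hW z)
  rw [hφ] at h1
  have h2 := expand_dvd_of_dvd_sq (NeZero.pos α) hc hc' hsq h0 h1
  rw [← hφ] at h2
  refine eq_zero_of_dvd_of_degree_lt h2 ?_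
  rw [degree_sym_toLaurent hW]
  exact degree_sym_lt (degree_rep_lt hW z)

theorem mem_weightOrder_of_isIntegral [IsReduced (CurveAlg W)] (hcop : Nat.Coprime α β) {φ : K[X]}
    (hφ : sym α β (β * W.natDegree) (toLaurent W) = expand K α φ) (hsq : Squarefree φ)
    (h0 : φ.coeff 0 ≠ 0) {z : CurveAlg W} (hz : IsIntegral K⟦X⟧ z) : z ∈ weightOrder hW hw := by
  rw [mem_weightOrder]
  by_cases hz0 : rep hW z = 0
  · rw [hz0]; exact WGe.zero 0
  obtain ⟨k, hk, hk'⟩ := exists_exact_weight (α := α) (β := β) hz0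
  refine hk.mono ?_
  by_contra hneg
  have hpow : ∀ j : ℕ, WGe α β (2 ^ j * k) (rep hW (z ^ 2 ^ j)) ∧
      sym α β (2 ^ j * k) (rep hW (z ^ 2 ^ j)) ≠ 0 := by
    intro j
    induction j with
    | zero => simpa using ⟨hk, hk'⟩
    | succ j ih =>
      have := sym_rep_sq_ne_zero hW hw hcop hφ hsq h0 ih.1 ih.2
      rw [← pow_add, show 2 ^ j + 2 ^ j = 2 ^ (j + 1) by ring] at this
      rwa [show (2 : ℤ) ^ (j + 1) * k = 2 ^ j * k + 2 ^ j * k by ring]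
  obtain ⟨J, hJ⟩ := exists_X_pow_smul_integral_mem_range hW
  have h1 := (X_pow_smul_mem_range_iff hW J _).1 (hJ _ (hz.pow (2 ^ (α * J))))
  obtain ⟨b, hb⟩ : ∃ b, (sym α β (2 ^ (α * J) * k) (rep hW (z ^ 2 ^ (α * J)))).coeff b ≠ 0 := by
    by_contra hc
    push Not at hc
    exact (hpow (α * J)).2 (Polynomial.ext hc)
  obtain ⟨a, ha, hab⟩ := exists_of_coeff_sym_ne_zero hb
  have h2 : -(J : ℤ) ≤ a := by
    by_contra hlt
    exact hab (h1 b a (not_le.1 hlt))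
  have h3 : ((α * J : ℕ) : ℤ) < 2 ^ (α * J) := by exact_mod_cast Nat.lt_two_pow_self
  have h4 : (0 : ℤ) ≤ β * b := by positivity
  have h5 : (1 : ℤ) ≤ α := by exact_mod_cast NeZero.pos α
  have h6 : (α : ℤ) * (-J) ≤ α * a := mul_le_mul_of_nonneg_left h2 (by omega)
  have h7 : (2 : ℤ) ^ (α * J) * k ≤ 2 ^ (α * J) * (-1) :=
    mul_le_mul_of_nonneg_left (by omega) (by positivity)
  push_cast at h3
  linarith

end Nondegenerate

section BranchPoints

open Polynomial
open scoped PowerSeries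

variable {K : Type u} [Field K] {α β : ℕ} [NeZero α]

theorem natDegree_le_one_of_squarefree [IsAlgClosed K] {φ : K[X]} (hsq : Squarefree φ)
    (h : ∀ a b, φ.IsRoot a → φ.IsRoot b → a = b) : φ.natDegree ≤ 1 := by
  by_contra hdeg
  have h0 : φ ≠ 0 := hsq.ne_zero
  have hd : φ.degree ≠ 0 := fun h' =>
    hdeg ((natDegree_eq_zero_iff_degree_le_zero.2 h'.le).trans_le zero_le_one)
  obtain ⟨a, ha⟩ := IsAlgClosed.exists_root φ hd
  obtain ⟨ψ, hψ⟩ := dvd_iff_isRoot.2 ha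
  have hψd : ψ.degree ≠ 0 := by
    intro h'
    rw [hψ, natDegree_mul (X_sub_C_ne_zero a) (by rintro rfl; simp at h'), natDegree_X_sub_C,
      natDegree_eq_zero_iff_degree_le_zero.2 h'.le] at hdeg
    exact hdeg le_rfl
  obtain ⟨b, hb⟩ := IsAlgClosed.exists_root ψ hψd
  have hb' : φ.IsRoot b := by rw [hψ, IsRoot, eval_mul, hb.eq_zero, mul_zero]
  obtain rfl := h a b ha hb'
  obtain ⟨χ, hχ⟩ := dvd_iff_isRoot.2 hb
  exact not_isUnit_X_sub_C a (hsq _ ⟨χ, by rw [hψ, hχ, mul_assoc]⟩)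

theorem exists_sym_eq_expand (hcop : Nat.Coprime α β) {k : ℤ} {P : (LaurentSeries K)[X]}
    (h0 : (sym α β k P).coeff 0 ≠ 0) : ∃ φ : K[X], sym α β k P = expand K α φ ∧ φ.coeff 0 ≠ 0 := by
  obtain ⟨c, hc, hc'⟩ := exists_mod_eq_of_coeff_sym_ne_zero hcop k P
  have hc0 : c = 0 := by rw [← hc' 0 h0, Nat.zero_mod]
  subst hc0
  obtain ⟨φ, hφ⟩ := exists_eq_X_pow_mul_expand (NeZero.pos α) hc hc'
  rw [pow_zero, one_mul] at hφ
  refine ⟨φ, hφ, ?_⟩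
  rw [hφ, coeff_expand (NeZero.pos α)] at h0
  simpa using h0

theorem isDomain_curveAlg {p : K⟦X⟧[X]} (hp : p.Monic) (hprime : Prime p) :
    IsDomain (CurveAlg p) := by
  have h1 : Irreducible (toLaurent p) :=
    (hp.irreducible_iff_irreducible_map_fraction_map (K := LaurentSeries K)).1 hprime.irreducible
  have := (Ideal.span_singleton_prime h1.ne_zero).2 h1.prime
  exact Ideal.Quotient.isDomain (Ideal.span {toLaurent p})

theorem sym_toLaurent_C (s : K⟦X⟧) :
    sym α β 0 (toLaurent (C s)) = C (PowerSeries.constantCoeff s) := by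
  ext b
  by_cases hb : b = 0
  · subst hb
    have := coeff_sym_toLaurent (α := α) (β := β) (C s) 0 0
    rw [mul_zero, mul_zero, add_zero, Nat.cast_zero, coeff_C_zero] at this
    rw [this, coeff_C_zero, PowerSeries.coeff_zero_eq_constantCoeff]
  · rw [coeff_C_of_ne_zero hb]
    by_contra hc
    obtain ⟨a, -, ha⟩ := exists_of_coeff_sym_ne_zero hc
    rw [coeff_map, coeff_C_of_ne_zero hb] at ha
    simp at ha

/-- The function `y ^ α / x ^ β`. -/
def slopePoly (K : Type u) [Field K] (α β : ℕ) : (LaurentSeries K)[X] :=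
  C (HahnSeries.single (-β : ℤ) (1 : K)) * X ^ α

theorem wge_slopePoly : WGe α β 0 (slopePoly K α β) := by
  rw [wge_iff]
  intro b a h
  rw [slopePoly, coeff_C_mul_X_pow] at h
  split_ifs at h with hb
  · subst hb
    have ha : a = -β := by
      by_contra hne
      exact h (HahnSeries.coeff_single_of_ne hne)
    rw [ha]
    linarith
  · simp at h

theorem sym_slopePoly : sym α β 0 (slopePoly K α β) = X ^ α := by
  ext b
  rw [coeff_X_pow]
  split_ifs with hb
  · subst hb
    have := coeff_sym (α := b) (β := β) (slopePoly K b β) (-β) b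
    rw [show ((b : ℕ) : ℤ) * (-β) + β * b = 0 by ring] at this
    rw [this, slopePoly, coeff_C_mul_X_pow, if_pos rfl, HahnSeries.coeff_single_same]
  · by_contra hc
    obtain ⟨a, -, ha⟩ := exists_of_coeff_sym_ne_zero hc
    rw [slopePoly, coeff_C_mul_X_pow, if_neg hb] at ha
    simp at ha

variable {W : K⟦X⟧[X]} (hW : W.Monic) (hw : WGe α β (β * W.natDegree) (toLaurent W))

include hW hw in
theorem eval_sym_modByMonic {b : K}
    (hb : (sym α β (β * W.natDegree) (toLaurent W)).eval b = 0) {P : (LaurentSeries K)[X]}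
    (hP : WGe α β 0 P) :
    (sym α β 0 (P %ₘ toLaurent W)).eval b = (sym α β 0 P).eval b := by
  obtain ⟨g, hg⟩ := sym_dvd_sym_modByMonic hW hw hP
  have := congrArg (eval b) hg
  rw [eval_sub, eval_mul, hb, zero_mul, sub_eq_zero] at this
  exact this.symm

/-- Evaluation of the leading part of an element of non-negative weight. -/
def evalHom (b : K) (hb : (sym α β (β * W.natDegree) (toLaurent W)).eval b = 0) :
    weightOrder hW hw →+* K where
  toFun z := (sym α β 0 (rep hW (z : CurveAlg W))).eval b
  map_one' := by
    have h1 : rep hW ((1 : weightOrder hW hw) : CurveAlg W) = 1 %ₘ toLaurent W := by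
      rw [← rep_mk hW, map_one (AdjoinRoot.mk _)]
      rfl
    rw [h1, eval_sym_modByMonic hW hw hb WGe.one, sym_one, eval_one]
  map_mul' z w := by
    have hz := (mem_weightOrder hW hw).1 z.2
    have hz' := (mem_weightOrder hW hw).1 w.2
    rw [MulMemClass.coe_mul, rep_mul, eval_sym_modByMonic hW hw hb
      (by simpa only [add_zero] using hz.mul hz')]
    have := sym_mul hz hz'
    rw [add_zero] at this
    rw [this, eval_mul]
  map_zero' := by
    rw [ZeroMemClass.coe_zero, map_zero, WGe.sym_eq_zero (k := 1) (by norm_num) (WGe.zero 1),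
      eval_zero]
  map_add' z w := by
    rw [AddMemClass.coe_add, map_add, sym_add, eval_add]

theorem evalHom_mk {b : K} (hb : (sym α β (β * W.natDegree) (toLaurent W)).eval b = 0)
    {P : (LaurentSeries K)[X]} (hP : WGe α β 0 P)
    (hmem : AdjoinRoot.mk (toLaurent W) P ∈ weightOrder hW hw) :
    evalHom hW hw b hb ⟨AdjoinRoot.mk (toLaurent W) P, hmem⟩ = (sym α β 0 P).eval b := by
  rw [← eval_sym_modByMonic hW hw hb hP, ← rep_mk hW]
  rfl

theorem evalHom_algebraMap {b : K} (hb : (sym α β (β * W.natDegree) (toLaurent W)).eval b = 0)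
    (s : K⟦X⟧) :
    evalHom hW hw b hb (algebraMap K⟦X⟧ _ s) = PowerSeries.constantCoeff s := by
  have h1 : evalHom hW hw b hb (algebraMap K⟦X⟧ _ s) =
      (sym α β 0 (rep hW (algebraMap K⟦X⟧ (CurveAlg W) s))).eval b := rfl
  rw [h1, rep_algebraMap, eval_sym_modByMonic hW hw hb (wge_toLaurent_zero _), sym_toLaurent_C,
    eval_C]

include hW hw in
theorem eq_of_isRoot_of_prime [IsAlgClosed K] (hprime : Prime W) {φ : K[X]}
    (hφ : sym α β (β * W.natDegree) (toLaurent W) = expand K α φ) {a₁ a₂ : K}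
    (h₁ : φ.IsRoot a₁) (h₂ : φ.IsRoot a₂) : a₁ = a₂ := by
  by_contra hne
  obtain ⟨b₁, rfl⟩ := IsAlgClosed.exists_pow_nat_eq a₁ (NeZero.pos α)
  obtain ⟨b₂, rfl⟩ := IsAlgClosed.exists_pow_nat_eq a₂ (NeZero.pos α)
  have := isDomain_curveAlg hW hprime
  have hb₁ : (sym α β (β * W.natDegree) (toLaurent W)).eval b₁ = 0 := by
    rw [hφ, expand_eval]; exact h₁
  have hb₂ : (sym α β (β * W.natDegree) (toLaurent W)).eval b₂ = 0 := by
    rw [hφ, expand_eval]; exact h₂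
  have hmem : AdjoinRoot.mk (toLaurent W) (slopePoly K α β) ∈ weightOrder hW hw := by
    rw [mem_weightOrder, rep_mk]
    exact wge_modByMonic_toLaurent hW hw wge_slopePoly
  let t : weightOrder hW hw := ⟨_, hmem⟩
  let q : weightOrder hW hw := t - algebraMap K⟦X⟧ _ (PowerSeries.C (b₁ ^ α))
  have hq : ∀ b (hb : (sym α β (β * W.natDegree) (toLaurent W)).eval b = 0),
      evalHom hW hw b hb q = b ^ α - b₁ ^ α := by
    intro b hb
    rw [map_sub, evalHom_algebraMap, evalHom_mk hW hw hb wge_slopePoly, sym_slopePoly, eval_pow,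
      eval_X, PowerSeries.constantCoeff_C]
  have hmax : ∀ b (hb : (sym α β (β * W.natDegree) (toLaurent W)).eval b = 0),
      ∀ s ∈ IsLocalRing.maximalIdeal K⟦X⟧, evalHom hW hw b hb (algebraMap K⟦X⟧ _ s) = 0 := by
    intro b hb s hs
    rw [evalHom_algebraMap]
    rw [IsLocalRing.mem_maximalIdeal, mem_nonunits_iff, PowerSeries.isUnit_iff_constantCoeff,
      isUnit_iff_ne_zero, not_not] at hs
    exact hs
  refine eval_ne_zero_of_eval_ne_zero (A := K⟦X⟧) (evalHom hW hw b₁ hb₁) (evalHom hW hw b₂ hb₂)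
    (hmax b₁ hb₁) (hmax b₂ hb₂) (q := q) ?_ ?_
  · rw [hq]
    exact sub_ne_zero.2 (Ne.symm hne)
  · rw [hq, sub_self]

include hW hw in
theorem natDegree_le_of_prime [IsAlgClosed K] (hprime : Prime W) {φ : K[X]}
    (hφ : sym α β (β * W.natDegree) (toLaurent W) = expand K α φ) (hsq : Squarefree φ) :
    W.natDegree ≤ α := by
  have h1 := natDegree_le_one_of_squarefree hsq fun a b ha hb =>
    eq_of_isRoot_of_prime hW hw hprime hφ ha hb
  have h2 := natDegree_eq_of_degree_eq_some (degree_sym_toLaurent (α := α) (β := β) hW)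
  rw [hφ, natDegree_expand] at h2
  nlinarith

end BranchPoints

section Homogenization

open Polynomial
open scoped PowerSeries

variable {K : Type u} [Field K] {α β : ℕ}

/-- The weighted homogenization of degree `α * β * d`, in which the `k`-th coefficient is carried
by `x ^ (β * (d - k)) * y ^ (α * k)`. -/
def weightedHomog (α β d : ℕ) (φ : K[X]) : PS K :=
  MvPolynomial.aeval ![Yv K ^ α, Xv K ^ β] (φ.homogenize d)

theorem weightedHomog_mul {φ ψ : K[X]} {c d : ℕ} (hφ : φ.natDegree ≤ c) (hψ : ψ.natDegree ≤ d) :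
    weightedHomog α β (c + d) (φ * ψ) = weightedHomog α β c φ * weightedHomog α β d ψ := by
  rw [weightedHomog, homogenize_mul _ _ hφ hψ, map_mul]
  rfl

theorem coef_weightedHomog (d : ℕ) (φ : K[X]) (p : ℕ × ℕ) :
    coef K (weightedHomog α β d φ) p =
      ∑ q ∈ Finset.HasAntidiagonal.antidiagonal d,
        if p = (β * q.2, α * q.1) then φ.coeff q.1 else 0 := by
  have hind : ∀ a b : ℕ, (Finsupp.single 0 a + Finsupp.single 1 b : Fin 2 →₀ ℕ) =
      Finsupp.single 0 p.1 + Finsupp.single 1 p.2 ↔ p = (a, b) := by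
    intro a b
    constructor
    · intro h
      have h0 := DFunLike.congr_fun h 0
      have h1 := DFunLike.congr_fun h 1
      simp at h0 h1
      exact Prod.ext h0.symm h1.symm
    · rintro rfl
      rfl
  rw [weightedHomog, homogenize, map_sum, coef, map_sum]
  refine Finset.sum_congr rfl fun q _ => ?_
  have h1 : MvPolynomial.aeval ![Yv K ^ α, Xv K ^ β]
      (MvPolynomial.monomial (Finsupp.update (Finsupp.single 0 q.1) 1 q.2) (φ.coeff q.1)) =
      MvPowerSeries.monomial (Finsupp.single 0 (β * q.2) + Finsupp.single 1 (α * q.1))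
        (φ.coeff q.1) := by
    rw [MvPolynomial.aeval_monomial, Finsupp.prod_fintype _ _ (by simp), Fin.prod_univ_two]
    have h0 : (Finsupp.update (Finsupp.single (0 : Fin 2) q.1) 1 q.2) 0 = q.1 := by simp
    have h1 : (Finsupp.update (Finsupp.single (0 : Fin 2) q.1) 1 q.2) 1 = q.2 := by simp
    rw [h0, h1]
    simp only [Matrix.cons_val_zero, Matrix.cons_val_one, Xv, Yv, ← pow_mul]
    rw [MvPowerSeries.X_pow_eq, MvPowerSeries.X_pow_eq, MvPowerSeries.monomial_mul_monomial,
      MvPowerSeries.algebraMap_apply, Algebra.algebraMap_self_apply,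
      ← MvPowerSeries.monomial_zero_eq_C_apply, MvPowerSeries.monomial_mul_monomial, zero_add,
      one_mul, mul_one, add_comm]
  rw [h1, MvPowerSeries.coeff_monomial]
  simp only [eq_comm (b := (Finsupp.single 0 (β * q.2) + Finsupp.single 1 (α * q.1) : Fin 2 →₀ ℕ)), hind]

theorem squarefree_of_weightedHomog (hα : 0 < α) (hβ : 0 < β) {d : ℕ} {φ : K[X]}
    (hφ : φ.natDegree ≤ d) (h : Squarefree (weightedHomog α β d φ)) : Squarefree φ := by
  have hφ0 : φ ≠ 0 := by
    rintro rfl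
    rw [weightedHomog, homogenize_zero, map_zero] at h
    exact h.ne_zero rfl
  rintro q ⟨r, rfl⟩
  have hq0 : q ≠ 0 := by rintro rfl; simp at hφ0
  have hr0 : r ≠ 0 := by rintro rfl; simp at hφ0
  rw [natDegree_mul (mul_ne_zero hq0 hq0) hr0, natDegree_mul hq0 hq0] at hφ
  obtain ⟨e, rfl⟩ := Nat.exists_eq_add_of_le hφ
  rw [add_assoc, weightedHomog_mul (natDegree_mul_le) (Nat.le_add_right _ _),
    weightedHomog_mul le_rfl le_rfl] at h
  have hu := h _ (Dvd.intro _ rfl)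
  rw [MvPowerSeries.isUnit_iff_constantCoeff, isUnit_iff_ne_zero] at hu
  by_contra hq
  refine hu ?_
  have hdeg : 0 < q.natDegree := by
    by_contra h0
    obtain ⟨c, rfl⟩ := natDegree_eq_zero.1 (Nat.eq_zero_of_not_pos h0)
    exact hq (isUnit_C.2 (isUnit_iff_ne_zero.2 (by simpa using hq0)))
  have := coef_weightedHomog (α := α) (β := β) q.natDegree q (0, 0)
  rw [coef] at this
  simp only [Finsupp.single_zero, add_zero] at this
  rw [MvPowerSeries.coeff_zero_eq_constantCoeff_apply] at this
  rw [this]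
  refine Finset.sum_eq_zero fun p hp => if_neg ?_
  rw [Finset.HasAntidiagonal.mem_antidiagonal] at hp
  intro heq
  have h1 := congrArg Prod.fst heq
  have h2 := congrArg Prod.snd heq
  simp only [zero_eq_mul] at h1 h2
  omega

theorem ext_coef {f g : PS K} (h : ∀ p, coef K f p = coef K g p) : f = g := by
  ext e
  have he : e = Finsupp.single 0 (e 0) + Finsupp.single 1 (e 1) := by
    ext i
    fin_cases i <;> simp
  rw [he]
  exact h (e 0, e 1)

theorem weightedHomog_eq_C_mul (hα : 0 < α) {d : ℕ} {φ : K[X]} {g : PS K} {c : K}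
    (hg : ∀ p, coef K g p ≠ 0 → ∃ k l, k + l = d ∧ p = (β * l, α * k))
    (hc : ∀ k l, k + l = d → φ.coeff k = c * coef K g (β * l, α * k)) :
    weightedHomog α β d φ = MvPowerSeries.C c * g := by
  refine ext_coef fun p => ?_
  have hR : coef K (MvPowerSeries.C c * g) p = c * coef K g p := by
    rw [coef, MvPowerSeries.coeff_C_mul, coef]
  rw [hR, coef_weightedHomog]
  by_cases hp : ∃ k l, k + l = d ∧ p = (β * l, α * k)
  · obtain ⟨k, l, hkl, rfl⟩ := hp
    rw [Finset.sum_eq_single (k, l), if_pos rfl, hc k l hkl]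
    · rintro ⟨k', l'⟩ hq hne
      rw [Finset.HasAntidiagonal.mem_antidiagonal] at hq
      refine if_neg fun heq => hne ?_
      have h2 : k = k' := Nat.eq_of_mul_eq_mul_left hα (congrArg Prod.snd heq)
      dsimp only at hq
      exact Prod.ext h2.symm (show l' = l by omega)
    · intro hq
      exact absurd (Finset.HasAntidiagonal.mem_antidiagonal.2 hkl) hq
  · have h0 : coef K g p = 0 := by
      by_contra h0
      exact hp (hg p h0)
    rw [h0, mul_zero]
    refine Finset.sum_eq_zero fun q hq => if_neg fun heq => ?_
    exact hp ⟨q.1, q.2, Finset.HasAntidiagonal.mem_antidiagonal.1 hq, heq⟩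

theorem squarefree_of_coef (hα : 0 < α) (hβ : 0 < β) {d : ℕ} {φ : K[X]} {g : PS K} {c : K}
    (hφ : φ.natDegree ≤ d) (hc0 : c ≠ 0)
    (hg : ∀ p, coef K g p ≠ 0 → ∃ k l, k + l = d ∧ p = (β * l, α * k))
    (hc : ∀ k l, k + l = d → φ.coeff k = c * coef K g (β * l, α * k))
    (hsq : Squarefree g) : Squarefree φ := by
  refine squarefree_of_weightedHomog hα hβ hφ ?_
  rw [weightedHomog_eq_C_mul hα hg hc]
  have hu : IsUnit (MvPowerSeries.C c : PS K) := (isUnit_iff_ne_zero.2 hc0).map MvPowerSeries.C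
  refine hsq.squarefree_of_dvd ?_
  exact (hu.dvd_mul_left.1 dvd_rfl)

end Homogenization

section NewtonPolygon

/-- A point of `T` of steepest descent from `(0, n)`, the last one on its line. -/
theorem exists_steepest {T : Set (ℕ × ℕ)} {n : ℕ} (hne : ∃ p ∈ T, p.2 < n) :
    ∃ q ∈ T, q.2 < n ∧ (∀ p ∈ T, q.1 * n ≤ (n - q.2) * p.1 + q.1 * p.2) ∧
      ∀ p ∈ T, (n - q.2) * p.1 + q.1 * p.2 = q.1 * n → p.1 ≤ q.1 := by
  let k : ℕ × ℕ → ℕ := fun p => p.1 * (n.factorial / (n - p.2))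
  have hk : ∀ p : ℕ × ℕ, p.2 < n → k p * (n - p.2) = p.1 * n.factorial := by
    intro p hp
    rw [mul_assoc, Nat.div_mul_cancel (Nat.dvd_factorial (by omega) (Nat.sub_le _ _))]
  obtain ⟨p₀, hp₀, hp₀n⟩ := hne
  obtain ⟨q, ⟨hqT, hqn⟩, hmin⟩ := WellFounded.has_min
    (InvImage.wf (fun p : ℕ × ℕ => k p * n + p.2) Nat.lt_wfRel.wf) {p | p ∈ T ∧ p.2 < n}
    ⟨p₀, hp₀, hp₀n⟩
  have hkey : ∀ p ∈ T, p.2 < n → k q * n + q.2 ≤ k p * n + p.2 := fun p hp hpn =>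
    not_lt.1 (hmin p ⟨hp, hpn⟩)
  have hle : ∀ p ∈ T, p.2 < n → k q ≤ k p := by
    intro p hp hpn
    have := hkey p hp hpn
    by_contra hlt
    have : (k p + 1) * n ≤ k q * n := Nat.mul_le_mul_right _ (by omega)
    rw [add_mul] at this
    omega
  have hfac : 0 < n.factorial := n.factorial_pos
  have hslope : ∀ p ∈ T, p.2 < n → q.1 * (n - p.2) ≤ p.1 * (n - q.2) := by
    intro p hp hpn
    refine Nat.le_of_mul_le_mul_left ?_ hfac
    calc n.factorial * (q.1 * (n - p.2)) = (q.1 * n.factorial) * (n - p.2) := by ring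
      _ = k q * ((n - q.2) * (n - p.2)) := by rw [← hk q hqn]; ring
      _ ≤ k p * ((n - q.2) * (n - p.2)) := Nat.mul_le_mul_right _ (hle p hp hpn)
      _ = (p.1 * n.factorial) * (n - q.2) := by rw [← hk p hpn]; ring
      _ = n.factorial * (p.1 * (n - q.2)) := by ring
  obtain ⟨e, he⟩ := Nat.exists_eq_add_of_lt hqn
  have hsub : n - q.2 = e + 1 := by omega
  simp only [hsub] at hslope
  refine ⟨q, hqT, hqn, fun p hp => ?_, fun p hp heq => ?_⟩
  · rw [hsub]
    rcases lt_or_ge p.2 n with hpn | hpn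
    · obtain ⟨i, hi⟩ := Nat.exists_eq_add_of_lt hpn
      have := hslope p hp hpn
      rw [show n - p.2 = i + 1 by omega] at this
      have hn : n = p.2 + (i + 1) := by omega
      calc q.1 * n = q.1 * p.2 + q.1 * (i + 1) := by rw [← mul_add, ← hn]
        _ ≤ q.1 * p.2 + p.1 * (e + 1) := Nat.add_le_add_left this _
        _ = _ := by ring
    · exact (Nat.mul_le_mul_left _ hpn).trans (Nat.le_add_left _ _)
  · rw [hsub] at heq
    rcases lt_or_ge p.2 n with hpn | hpn
    · obtain ⟨i, hi⟩ := Nat.exists_eq_add_of_lt hpn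
      have hi' : n - p.2 = i + 1 := by omega
      have hn : n = p.2 + (i + 1) := by omega
      have heq' : q.1 * (i + 1) = p.1 * (e + 1) := by
        have : q.1 * n = q.1 * p.2 + q.1 * (i + 1) := by rw [← mul_add, ← hn]
        linarith [heq, mul_comm (e + 1) p.1]
      have hkk : k q = k p := by
        have h1 := hk q hqn
        have h2 := hk p hpn
        rw [hsub] at h1
        rw [hi'] at h2
        refine Nat.eq_of_mul_eq_mul_right (show 0 < (e + 1) * (i + 1) by positivity) ?_
        calc k q * ((e + 1) * (i + 1)) = (k q * (e + 1)) * (i + 1) := by ring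
          _ = (q.1 * (i + 1)) * n.factorial := by rw [h1]; ring
          _ = (p.1 * n.factorial) * (e + 1) := by rw [heq']; ring
          _ = k p * ((e + 1) * (i + 1)) := by rw [← h2]; ring
      have hq2 : q.2 ≤ p.2 := by
        have := hkey p hp hpn
        rw [hkk] at this
        omega
      refine Nat.le_of_mul_le_mul_right ?_ (show 0 < e + 1 by positivity)
      rw [← heq']
      exact Nat.mul_le_mul_left _ (by omega)
    · have h1 : q.1 * n ≤ q.1 * p.2 := Nat.mul_le_mul_left _ hpn
      have h2 : (e + 1) * p.1 = 0 := by omega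
      have h3 : p.1 = 0 := by simpa using h2
      omega

variable {K : Type u} [Field K] {f : PS K} {S : NEdge} {m n : ℕ}

theorem newtonPolygon_eq_singleton (hS : newtonPolygon K f = {S})
    (h00 : (0, 0) ∉ supp K f) (hm : (m, 0) ∈ supp K f) (hm' : ∀ a < m, (a, 0) ∉ supp K f)
    (hn : (0, n) ∈ supp K f) (hn' : ∀ b < n, (0, b) ∉ supp K f) :
    S.A = (0, n) ∧ S.B = (m, 0) ∧ ∀ p ∈ supp K f, m * n ≤ n * p.1 + m * p.2 := by
  have hm0 : 0 < m := Nat.pos_of_ne_zero (by rintro rfl; exact h00 hm)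
  have hn0 : 0 < n := Nat.pos_of_ne_zero (by rintro rfl; exact h00 hn)
  obtain ⟨q, hqT, hqn, hle, heq⟩ := exists_steepest (T := supp K f) (n := n) ⟨_, hm, hn0⟩
  have hq1 : 0 < q.1 := Nat.pos_of_ne_zero fun h => hn' q.2 hqn (by
    rw [← h]; exact hqT)
  have hA : (⟨(0, n), q, hq1, hqn⟩ : NEdge) ∈ newtonPolygon K f := by
    refine ⟨hn, hqT, (n - q.2, q.1), Nat.sub_pos_of_lt hqn, hq1, ?_, fun p hp => ?_,
      fun p hp h => ⟨Nat.zero_le _, heq p hp ?_⟩⟩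
    · obtain ⟨e, rfl⟩ := Nat.exists_eq_add_of_lt hqn
      simp only [add_assoc, Nat.add_sub_cancel_left]
      ring
    · simpa using hle p hp
    · simpa using h
  obtain ⟨s, hsT, hsm, hle', heq'⟩ :=
    exists_steepest (T := Prod.swap ⁻¹' supp K f) (n := m) ⟨(n, 0), hn, hm0⟩
  have hs1 : 0 < s.1 := Nat.pos_of_ne_zero fun h => hm' s.2 hsm (by
    rw [← h]; exact hsT)
  have hB : (⟨s.swap, (m, 0), hsm, hs1⟩ : NEdge) ∈ newtonPolygon K f := by
    have h1 : s.1 * s.2 + (m - s.2) * s.1 = s.1 * m := by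
      rw [mul_comm (m - s.2), ← mul_add, Nat.add_sub_cancel' hsm.le]
    refine ⟨hsT, hm, (s.1, m - s.2), hs1, Nat.sub_pos_of_lt hsm, ?_, fun p hp => ?_,
      fun p hp h => ?_⟩
    · simpa using h1.symm
    · have := hle' p.swap (by simpa using hp)
      simp only [Prod.fst_swap, Prod.snd_swap] at this ⊢
      omega
    · simp only [Prod.fst_swap, Prod.snd_swap] at h ⊢
      have h2 := heq' p.swap (by simpa using hp) (by
        simp only [Prod.fst_swap, Prod.snd_swap]
        omega)
      rw [Prod.fst_swap] at h2
      have h3 : (m - s.2) * p.2 ≤ (m - s.2) * s.1 := Nat.mul_le_mul_left _ h2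
      exact ⟨Nat.le_of_mul_le_mul_left (by omega) hs1, Nat.le_of_mul_le_mul_left (by omega) hs1⟩
  rw [hS, Set.mem_singleton_iff] at hA hB
  have hAS : S.A = (0, n) := by rw [← hA]
  have hBS : S.B = (m, 0) := by rw [← hB]
  have hq : q = (m, 0) := by rw [← hBS, ← hA]
  refine ⟨hAS, hBS, fun p hp => ?_⟩
  have := hle p hp
  rw [hq] at this
  simpa using this

theorem inBar_support {d α β : ℕ} (hd : 0 < d) (hα : 0 < α) (hcop : Nat.Coprime α β)
    (hn : n = α * d) (hm : m = β * d) (hA : S.A = (0, n)) (hB : S.B = (m, 0)) :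
    (∀ p, coef K (inBar K f S) p ≠ 0 → ∃ k l, k + l = d ∧ p = (β * l, α * k)) ∧
      ∀ k l, k + l = d → coef K (inBar K f S) (β * l, α * k) = coef K f (β * l, α * k) := by
  have hcoef : ∀ p, coef K (inBar K f S) p = if S.mem p then coef K f p else 0 := by
    intro p
    have h : coef K (inBar K f S) p =
        if S.mem (p.1 + S.A.1, p.2 + S.B.2) then coef K f (p.1 + S.A.1, p.2 + S.B.2) else 0 := by
      have h1 : ∀ c : ℕ × ℕ → K, coef K (ofCoef K c) p = c p := fun c => by
        change c _ = c p
        simp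
      exact h1 _
    rw [h, hA, hB]
    rfl
  subst hn hm
  constructor
  · intro p hp
    rw [hcoef] at hp
    split_ifs at hp with hmem
    · obtain ⟨-, -, -, h4, h5⟩ := hmem
      simp only [NEdge.len1, NEdge.len2, hA, hB, Nat.sub_zero] at h4 h5
      have h6 : p.1 * α = (α * d - p.2) * β := by
        refine Nat.eq_of_mul_eq_mul_right hd ?_
        rw [mul_assoc, h5, mul_assoc]
      obtain ⟨l, hl⟩ : α ∣ α * d - p.2 := hcop.dvd_of_dvd_mul_right ⟨p.1, by rw [← h6, mul_comm]⟩
      have hp2 : p.2 = α * d - α * l := by omega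
      have hld : l ≤ d := Nat.le_of_mul_le_mul_left (by omega) hα
      refine ⟨d - l, l, by omega, Prod.ext ?_ ?_⟩
      · refine Nat.eq_of_mul_eq_mul_right hα ?_
        rw [h6, hl]
        ring
      · rw [hp2, Nat.mul_sub]
    · exact absurd rfl hp
  · rintro k l rfl
    rw [hcoef, if_pos]
    simp only [NEdge.mem, NEdge.len1, NEdge.len2, hA, hB, Nat.sub_zero, Nat.zero_le, true_and]
    refine ⟨Nat.mul_le_mul_left _ (by omega), Nat.mul_le_mul_left _ (by omega), ?_⟩
    rw [← Nat.mul_sub, Nat.add_sub_cancel_left]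
    ring

end NewtonPolygon

section MainTheorem

open Polynomial
open scoped PowerSeries

variable {K : Type u} [Field K] {α β : ℕ} [NeZero α]

theorem natDegree_eq_of_mem [IsAlgClosed K] (hcop : Nat.Coprime α β) {W : K⟦X⟧[X]}
    {s : Multiset K⟦X⟧[X]} (hs : ∀ p ∈ s, p.Monic ∧ Prime p) (hprod : s.prod = W)
    (hw : WGe α β (β * W.natDegree) (toLaurent W)) {φ : K[X]}
    (hφ : sym α β (β * W.natDegree) (toLaurent W) = expand K α φ) (hsq : Squarefree φ)
    (h0 : (sym α β (β * W.natDegree) (toLaurent W)).coeff 0 ≠ 0) {p : K⟦X⟧[X]} (hp : p ∈ s) :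
    p.natDegree = α := by
  obtain ⟨hwp, hdvd⟩ := wge_of_mem (fun q hq => (hs q hq).1) hprod hw hp
  have h0p : (sym α β (β * p.natDegree) (toLaurent p)).coeff 0 ≠ 0 := by
    obtain ⟨g, hg⟩ := hdvd
    intro h
    rw [hg, mul_coeff_zero, h, zero_mul] at h0
    exact h0 rfl
  obtain ⟨ψ, hψ, -⟩ := exists_sym_eq_expand hcop h0p
  have hψφ : ψ ∣ φ := dvd_of_expand_dvd_expand (NeZero.pos α) (by rw [← hψ, ← hφ]; exact hdvd)
  have hle := natDegree_le_of_prime (hs p hp).1 hwp (hs p hp).2 hψ (hsq.squarefree_of_dvd hψφ)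
  obtain ⟨e, he, hpe⟩ := natDegree_ge_of_mem hcop hs hprod hw h0 hp
  have : α * 1 ≤ α * e := Nat.mul_le_mul_left _ he
  omega

theorem numFactors_le_and_le_delta [IsAlgClosed K] {f : PS K} {S : NEdge} {d : ℕ}
    (hf : Squarefree f) (hβ : 0 < β) (hd : 0 < d) (hcop : Nat.Coprime α β)
    (hA : S.A = (0, α * d)) (hB : S.B = (β * d, 0)) (hS : S ∈ newtonPolygon K f)
    (hsupp : ∀ p ∈ supp K f, β * (α * d) ≤ α * p.1 + β * p.2) :
    numFactors K f ≤ d ∧ α * d * (β * d) + d ≤ 2 * delta K f + α * d + β * d ∧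
      (NonDegenerate K f → numFactors K f = d ∧
        2 * delta K f + α * d + β * d = α * d * (β * d) + d) := by
  have hα : 0 < α := NeZero.pos α
  have hmA : coef K f (0, α * d) ≠ 0 := by rw [← hA]; exact hS.1
  have hmB : coef K f (β * d, 0) ≠ 0 := by rw [← hB]; exact hS.2.1
  have hlt : ∀ b < α * d, coef K f (0, b) = 0 := by
    intro b hb
    by_contra hne
    have := hsupp (0, b) hne
    rw [mul_zero, zero_add] at this
    exact absurd (Nat.le_of_mul_le_mul_left this hβ) (not_le.2 hb)
  obtain ⟨W, h, H, hdeg, hwt, c, hc, hcoef⟩ := exists_weierstrass f hα hβ hmA hlt hsupp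
  have hW : W.Monic := H.isDistinguishedAt.monic
  have hw : WGe α β (β * W.natDegree) (toLaurent W) := by
    have := wge_toLaurent_iff.2 hwt
    rw [hdeg]
    exact_mod_cast this
  have hsymcoeff : ∀ a b, α * a + β * b = β * (α * d) →
      (sym α β (β * W.natDegree) (toLaurent W)).coeff b = c * coef K f (a, b) := by
    intro a b hab
    have := coeff_sym_toLaurent (α := α) (β := β) W a b
    rw [hcoef a b hab, hab] at this
    rw [hdeg]
    exact_mod_cast this
  have h0 : (sym α β (β * W.natDegree) (toLaurent W)).coeff 0 ≠ 0 := by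
    rw [hsymcoeff (β * d) 0 (by ring)]
    exact mul_ne_zero hc hmB
  obtain ⟨s, hs, hprod⟩ := exists_monic_prime_factors _ W hW rfl
  have hcard := numFactors_eq_card H hf hβ hs hprod hw
  have hred := isReduced_curveAlg hW (squarefree_of_factorization H hf hβ hs hprod hw)
  obtain ⟨hsum, hsum'⟩ := sum_le_delta H hW hw hred
  rw [hdeg] at hsum hsum'
  have htwo := two_mul_sum_div hα hd hcop
  refine ⟨?_, by omega, fun hnd => ?_⟩
  · have := card_mul_le (fun p hp => (hs p hp).1) fun p hp =>
      natDegree_ge_of_mem hcop hs hprod hw h0 hp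
    rw [hprod, hdeg, mul_comm α] at this
    rw [hcard]
    exact Nat.le_of_mul_le_mul_right this hα
  · obtain ⟨φ, hφ, hφ0⟩ := exists_sym_eq_expand hcop h0
    have hφdeg : φ.natDegree ≤ d := by
      have h2 := natDegree_eq_of_degree_eq_some (degree_sym_toLaurent (α := α) (β := β) hW)
      rw [hφ, natDegree_expand, hdeg, mul_comm] at h2
      exact (Nat.eq_of_mul_eq_mul_left hα h2).le
    obtain ⟨hin, hin'⟩ := inBar_support (f := f) hd hα hcop rfl rfl hA hB
    have hsq : Squarefree φ := by
      refine squarefree_of_coef hα hβ hφdeg hc hin (fun k l hkl => ?_) (hnd S hS)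
      rw [hin' k l hkl, ← hsymcoeff (β * l) (α * k) (by rw [← hkl]; ring), hφ, mul_comm α,
        coeff_expand_mul hα]
    constructor
    · have := card_mul_eq (fun p hp => (hs p hp).1) fun p hp =>
        natDegree_eq_of_mem hcop hs hprod hw hφ hsq h0 hp
      rw [hprod, hdeg, mul_comm α] at this
      rw [hcard]
      exact (Nat.eq_of_mul_eq_mul_right hα this).symm
    · rw [hsum' fun z hz => mem_weightOrder_of_isIntegral hW hw hcop hφ hsq hφ0 hz]
      exact htwo

end MainTheorem

theorem muBar_elementary (K : Type u) [Field K] [IsAlgClosed K]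
    (f : PS K) (hred : IsReducedSeries K f)
    (hconv : Convenient K f) (S : NEdge) (hS : newtonPolygon K f = {S})
    (m n d : ℕ) (hm : m = ordX K f) (hn : n = ordY K f) (hd : d = Nat.gcd m n) :
    ((d : ℤ) - (numFactors K f : ℤ) ≥ 0 ∧
      muBar K f - ((n : ℤ) - 1) * ((m : ℤ) - 1) ≥ (d : ℤ) - (numFactors K f : ℤ)) ∧
      (NonDegenerate K f →
        muBar K f = ((n : ℤ) - 1) * ((m : ℤ) - 1) ∧ numFactors K f = d) := by
  have h00 : (0, 0) ∉ supp K f := by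
    intro h
    refine h ?_
    simp only [coef, Finsupp.single_zero, add_zero]
    exact (MvPowerSeries.coeff_zero_eq_constantCoeff_apply f).trans hred.2.1
  have hmS : (m, 0) ∈ supp K f := hm ▸ Nat.sInf_mem (s := {a | (a, 0) ∈ supp K f}) hconv.1
  have hnS : (0, n) ∈ supp K f := hn ▸ Nat.sInf_mem (s := {b | (0, b) ∈ supp K f}) hconv.2
  have hm' : ∀ a < m, (a, 0) ∉ supp K f := fun a ha =>
    Nat.notMem_of_lt_sInf (s := {a | (a, 0) ∈ supp K f}) (ha.trans_eq hm)
  have hn' : ∀ b < n, (0, b) ∉ supp K f := fun b hb =>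
    Nat.notMem_of_lt_sInf (s := {b | (0, b) ∈ supp K f}) (hb.trans_eq hn)
  obtain ⟨hA, hB, hsupp⟩ := newtonPolygon_eq_singleton hS h00 hmS hm' hnS hn'
  have hm0 : 0 < m := Nat.pos_of_ne_zero (by rintro rfl; exact h00 hmS)
  have hn0 : 0 < n := Nat.pos_of_ne_zero (by rintro rfl; exact h00 hnS)
  have hd0 : 0 < d := hd ▸ Nat.gcd_pos_of_pos_left n hm0
  clear hm hn hm' hn'
  obtain ⟨β, α, hcop, hmβ, hnα⟩ := Nat.exists_coprime m n
  rw [← hd] at hmβ hnα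
  subst hmβ hnα
  have hα : α ≠ 0 := by rintro rfl; simp at hn0
  have hβ : 0 < β := Nat.pos_of_mul_pos_right hm0
  have : NeZero α := ⟨hα⟩
  obtain ⟨h1, h2, h3⟩ := numFactors_le_and_le_delta hred.2.2 hβ hd0 hcop.symm hA hB
    (by rw [hS]; rfl) fun p hp => by
      have := hsupp p hp
      refine Nat.le_of_mul_le_mul_left ?_ hd0
      linarith
  zify at h1 h2
  refine ⟨⟨by linarith, ?_⟩, fun hnd => ?_⟩
  · rw [muBar]
    push_cast
    linarith
  · obtain ⟨h4, h5⟩ := h3 hnd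
    refine ⟨?_, h4⟩
    zify at h4 h5
    rw [muBar]
    push_cast
    linarith

end PlaneCurveNote
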